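/- For every positive integer n there exists a constant M ≥ 1 with the following property. Let Ω ⊂ ℝ^{2n} be a regular domain, A ∈ ℝ^{2n×2n}, α ∈ [0,1) and δ > 0. Then there exists a continuous map u : closure(Ω) → ℝ^{2n} with u ∈ W^{1,1}(Ω;ℝ^{2n}) ∩ C^α(closure(Ω);ℝ^{2n}) such that: (i) u(x) = Ax for all x ∈ ∂Ω; (ii) ‖u − l_A‖_{C^α(closure(Ω))} < δ; (iii) the weak gradient satisfies ∇u(x) ∈ L ∩ Σ for almost every x ∈ Ω; and (iv) |{x ∈ Ω : |∇u(x)| > t}| ≤ M(1+|A|²) t^{−2} |Ω| for every t > 0. In particular u ∈ W^{1,p}(Ω) for every p < 2, and if A ∉ L then u is not split, i.e. there exist no functions f₁, f₂ from the coordinate projections of Ω to ℝ^n such that u(x,y) = (f₁(x), f₂(y)) for all (x,y) ∈ Ω or u(x,y) = (f₂(y), f₁(x)) for all (x,y) ∈ Ω. -/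

import Mathlib

open MeasureTheory Set Filter Topology

noncomputable section

namespace Paper

variable {ι κ : Type*}

/-- Frobenius (Hilbert–Schmidt) norm of a matrix. -/
def frobNorm [Fintype ι] [Fintype κ] (A : Matrix κ ι ℝ) : ℝ :=
  Real.sqrt (∑ k, ∑ i, (A k i) ^ 2)

/-- Frobenius distance from a matrix to a set of matrices. -/
def frobDist [Fintype ι] [Fintype κ] (X : Matrix κ ι ℝ) (S : Set (Matrix κ ι ℝ)) : ℝ :=
  sInf ((fun Y => frobNorm (X - Y)) '' S)

/-- The affine map `x ↦ A x + b`. -/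
def lmap [Fintype ι] (A : Matrix κ ι ℝ) (b : κ → ℝ) (x : ι → ℝ) : κ → ℝ :=
  fun k => (∑ i, A k i * x i) + b k

/-- A regular domain: open, bounded, connected, with Lebesgue-null boundary. -/
def IsRegularDomain [Fintype ι] (Ω : Set (ι → ℝ)) : Prop :=
  IsOpen Ω ∧ Bornology.IsBounded Ω ∧ IsConnected Ω ∧ volume (frontier Ω) = 0

/-- `u` agrees with an affine map on `S`. -/
def IsAffineOn [Fintype ι] (u : (ι → ℝ) → κ → ℝ) (S : Set (ι → ℝ)) : Prop :=
  ∃ (B : Matrix κ ι ℝ) (c : κ → ℝ), ∀ x ∈ S, u x = lmap B c x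

/-- `u` is piecewise affine on `Ω`. -/
def IsPiecewiseAffineOn [Fintype ι] (u : (ι → ℝ) → κ → ℝ) (Ω : Set (ι → ℝ)) : Prop :=
  ∃ 𝒮 : Set (Set (ι → ℝ)), 𝒮.Countable ∧
    (∀ V ∈ 𝒮, IsRegularDomain V ∧ V ⊆ Ω ∧ IsAffineOn u V) ∧
    𝒮.PairwiseDisjoint id ∧ volume (Ω \ ⋃₀ 𝒮) = 0

/-- `G` is the weak (distributional) gradient of `u` on `Ω`, and `u ∈ W^{1,1}(Ω)`. -/
structure HasWeakGradientOn [Fintype ι] [DecidableEq ι] [Fintype κ]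
    (u : (ι → ℝ) → κ → ℝ) (G : (ι → ℝ) → Matrix κ ι ℝ) (Ω : Set (ι → ℝ)) : Prop where
  integrable : IntegrableOn u Ω volume
  integrable_grad : ∀ (k : κ) (i : ι), IntegrableOn (fun x => G x k i) Ω volume
  parts : ∀ φ : (ι → ℝ) → ℝ, (∀ n : ℕ, ContDiff ℝ n φ) → HasCompactSupport φ →
    tsupport φ ⊆ Ω → ∀ (k : κ) (i : ι),
      ∫ x in Ω, u x k * fderiv ℝ φ x (Pi.single i 1) = - ∫ x in Ω, G x k i * φ x

/-- Membership in `C^α(S)`: continuous on `S` and (for `α > 0`) `α`-Hölder on `S`. -/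
def MemHolder [Fintype ι] [Fintype κ] (α : ℝ) (S : Set (ι → ℝ)) (u : (ι → ℝ) → κ → ℝ) : Prop :=
  ContinuousOn u S ∧ ∃ C : ℝ, ∀ x ∈ S, ∀ y ∈ S, dist (u x) (u y) ≤ C * dist x y ^ α

/-- The `C^α` norm on `S`. -/
def holderNorm [Fintype ι] [Fintype κ] (α : ℝ) (S : Set (ι → ℝ)) (u : (ι → ℝ) → κ → ℝ) : ℝ :=
  sSup ((fun x => ‖u x‖) '' S) +
    sSup {r : ℝ | ∃ x ∈ S, ∃ y ∈ S, x ≠ y ∧ r = dist (u x) (u y) / dist x y ^ α}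

/-- `K` can be reduced to `K'` in weak `L^p`, with constant `M`. -/
def ReducesWith [Fintype ι] [DecidableEq ι] [Fintype κ] (M : ℝ)
    (K K' : Set (Matrix κ ι ℝ)) (p : ℝ) : Prop :=
  ∀ A ∈ K, ∀ b : κ → ℝ, ∀ ε ∈ Set.Ioo (0:ℝ) 1, ∀ α ∈ Set.Ioo (0:ℝ) 1, ∀ s ∈ Set.Ioi (1:ℝ),
    ∀ Ω : Set (ι → ℝ), IsRegularDomain Ω →
      ∃ (u : (ι → ℝ) → κ → ℝ) (G : (ι → ℝ) → Matrix κ ι ℝ),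
        IsPiecewiseAffineOn u Ω ∧ HasWeakGradientOn u G Ω ∧ MemHolder α (closure Ω) u ∧
        (∀ x ∈ frontier Ω, u x = lmap A b x) ∧
        (∫ x in {x ∈ Ω | G x ∉ K'}, (1 + frobNorm (G x)) ^ s) < ε * (volume Ω).toReal ∧
        ∀ t : ℝ, 0 < t →
          volume {x ∈ Ω | t < frobNorm (G x)}
            ≤ ENNReal.ofReal (M ^ p * (1 + frobNorm A ^ p) * t ^ (-p)) * volume Ω

/-- `K` can be reduced to `K'` in weak `L^p`. -/
def ReducedTo [Fintype ι] [DecidableEq ι] [Fintype κ]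
    (K K' : Set (Matrix κ ι ℝ)) (p : ℝ) : Prop :=
  ∃ M : ℝ, 1 ≤ M ∧ ReducesWith M K K' p


/-- Block-diagonal `2n×2n` matrices (w.r.t. the splitting `ℝ^{2n} = ℝ^n × ℝ^n`). -/
def L1set (n : ℕ) : Set (Matrix (Fin n ⊕ Fin n) (Fin n ⊕ Fin n) ℝ) :=
  {X | (∀ i j, X (Sum.inl i) (Sum.inr j) = 0) ∧ (∀ i j, X (Sum.inr i) (Sum.inl j) = 0)}

/-- Block anti-diagonal `2n×2n` matrices. -/
def L2set (n : ℕ) : Set (Matrix (Fin n ⊕ Fin n) (Fin n ⊕ Fin n) ℝ) :=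
  {X | (∀ i j, X (Sum.inl i) (Sum.inl j) = 0) ∧ (∀ i j, X (Sum.inr i) (Sum.inr j) = 0)}

/-- Split matrices `L = L₁ ∪ L₂`. -/
def LSet (n : ℕ) : Set (Matrix (Fin n ⊕ Fin n) (Fin n ⊕ Fin n) ℝ) := L1set n ∪ L2set n

/-- Matrices of determinant one. -/
def SigmaSet (n : ℕ) : Set (Matrix (Fin n ⊕ Fin n) (Fin n ⊕ Fin n) ℝ) := {X | X.det = 1}

/-- `u` preserves (or reverses) the product structure on `Ω`, i.e. `u` is split. -/
def IsSplitOn (n : ℕ) (u : ((Fin n ⊕ Fin n) → ℝ) → (Fin n ⊕ Fin n) → ℝ)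
    (Ω : Set ((Fin n ⊕ Fin n) → ℝ)) : Prop :=
  (∃ f₁ f₂ : (Fin n → ℝ) → (Fin n → ℝ), ∀ z ∈ Ω,
      (∀ i, u z (Sum.inl i) = f₁ (fun j => z (Sum.inl j)) i) ∧
      (∀ i, u z (Sum.inr i) = f₂ (fun j => z (Sum.inr j)) i)) ∨
  (∃ f₁ f₂ : (Fin n → ℝ) → (Fin n → ℝ), ∀ z ∈ Ω,
      (∀ i, u z (Sum.inl i) = f₂ (fun j => z (Sum.inr j)) i) ∧
      (∀ i, u z (Sum.inr i) = f₁ (fun j => z (Sum.inl j)) i))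

/-! ### Locally affine scalar functions -/

/-- `f` coincides near `x` with an affine function of slope `L`. -/
def IsLocAffineAt [Fintype ι] (f : (ι → ℝ) → ℝ) (L : (ι → ℝ) →L[ℝ] ℝ) (x : ι → ℝ) : Prop :=
  ∀ᶠ y in 𝓝 x, f y = f x + L (y - x)

/-- Almost everywhere, `f` is locally affine with slope in `S`. -/
def AELocAffine [Fintype ι] (S : Set ((ι → ℝ) →L[ℝ] ℝ)) (f : (ι → ℝ) → ℝ) : Prop :=
  ∀ᵐ x, ∃ L ∈ S, IsLocAffineAt f L x

section LocAffine

variable [Fintype ι] {f g : (ι → ℝ) → ℝ} {L M : (ι → ℝ) →L[ℝ] ℝ} {x : ι → ℝ}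

lemma IsLocAffineAt.congr (h : IsLocAffineAt f L x) (hfg : g =ᶠ[𝓝 x] f) :
    IsLocAffineAt g L x := by
  filter_upwards [h, hfg] with y hy hy'
  rw [hy', hy, hfg.self_of_nhds]

lemma isLocAffineAt_clm (L : (ι → ℝ) →L[ℝ] ℝ) (x : ι → ℝ) : IsLocAffineAt L L x :=
  Eventually.of_forall fun y => by simp

lemma IsLocAffineAt.hasFDerivAt (h : IsLocAffineAt f L x) : HasFDerivAt f L x := by
  have : HasFDerivAt (fun y => f x + L (y - x)) L x := by
    simpa using (L.hasFDerivAt.comp x ((hasFDerivAt_id x).sub_const x)).const_add (f x)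
  exact this.congr_of_eventuallyEq h

lemma IsLocAffineAt.continuousAt (h : IsLocAffineAt f L x) : ContinuousAt f x :=
  h.hasFDerivAt.continuousAt

lemma IsLocAffineAt.neg (h : IsLocAffineAt f L x) : IsLocAffineAt (fun y => -f y) (-L) x := by
  filter_upwards [h] with y hy
  rw [hy, neg_apply]; ring

lemma IsLocAffineAt.sub (h : IsLocAffineAt f L x) (h' : IsLocAffineAt g M x) :
    IsLocAffineAt (fun y => f y - g y) (L - M) x := by
  filter_upwards [h, h'] with y hy hy'
  rw [hy, hy', sub_apply]; ring

lemma IsLocAffineAt.sub_const (h : IsLocAffineAt f L x) (c : ℝ) :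
    IsLocAffineAt (fun y => f y - c) L x := by
  filter_upwards [h] with y hy
  rw [hy]; ring

lemma IsLocAffineAt.const_mul (h : IsLocAffineAt f L x) (c : ℝ) :
    IsLocAffineAt (fun y => c * f y) (c • L) x := by
  filter_upwards [h] with y hy
  rw [hy]; simp [mul_add]

lemma measure_hyperplane (hL : L ≠ 0) (x : ι → ℝ) : volume {y | L (y - x) = 0} = 0 := by
  have h1 : volume ((LinearMap.ker L.toLinearMap : Submodule ℝ (ι → ℝ)) : Set (ι → ℝ)) = 0 := by
    apply Measure.addHaar_submodule
    intro h
    apply hL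
    ext y
    have : y ∈ LinearMap.ker L.toLinearMap := by rw [h]; trivial
    simpa using this
  have h2 := measure_preimage_add_right (volume : Measure (ι → ℝ)) (-x)
    ((LinearMap.ker L.toLinearMap : Submodule ℝ (ι → ℝ)) : Set (ι → ℝ))
  rw [h1] at h2
  refine measure_mono_null ?_ h2
  intro y hy
  simpa [sub_eq_add_neg] using hy

lemma AELocAffine.ae_ne {S : Set ((ι → ℝ) →L[ℝ] ℝ)} (h : AELocAffine S f) (hS : (0 : _) ∉ S)
    (c : ℝ) : ∀ᵐ x, f x ≠ c := by
  have h0 : volume {x | f x = c ∧ ∃ L ∈ S, IsLocAffineAt f L x} = 0 := by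
    apply measure_null_of_locally_null
    rintro x ⟨hx, L, hL, hloc⟩
    refine ⟨{y | f y = c ∧ ∃ L ∈ S, IsLocAffineAt f L y} ∩ {y | f y = f x + L (y - x)},
      inter_mem self_mem_nhdsWithin (mem_nhdsWithin_of_mem_nhds hloc), ?_⟩
    refine measure_mono_null ?_ (measure_hyperplane (L := L) (fun h => hS (h ▸ hL)) x)
    rintro y ⟨⟨hy, -⟩, hy'⟩
    simp only [mem_ofPred_eq] at hy' ⊢
    linarith
  have h1 : ∀ᵐ x, ¬ (f x = c ∧ ∃ L ∈ S, IsLocAffineAt f L x) := by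
    rw [ae_iff]; simpa using h0
  filter_upwards [h, h1] with x hx hx' hc
  exact hx' ⟨hc, hx⟩

lemma IsLocAffineAt.abs (h : IsLocAffineAt f L x) (h0 : f x ≠ 0) :
    IsLocAffineAt (fun y => |f y|) L x ∨ IsLocAffineAt (fun y => |f y|) (-L) x := by
  rcases lt_or_gt_of_ne h0 with h0 | h0
  · right
    refine h.neg.congr ?_
    filter_upwards [h.continuousAt.eventually_lt continuousAt_const h0] with y hy
    exact abs_of_neg hy
  · left
    refine h.congr ?_
    filter_upwards [continuousAt_const.eventually_lt h.continuousAt h0] with y hy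
    exact abs_of_pos hy

lemma AELocAffine.abs_sub (hL : L ≠ 0) (h : AELocAffine {L, -L} f) (c : ℝ) :
    AELocAffine {L, -L} (fun x => |f x - c|) := by
  filter_upwards [h, h.ae_ne (by simp [hL, eq_comm]) c] with x hx hne
  obtain ⟨M, hM, hx⟩ := hx
  have := (hx.sub_const c).abs (sub_ne_zero.mpr hne)
  rcases hM with rfl | rfl
  · rcases this with h | h
    exacts [⟨_, by simp, h⟩, ⟨_, by simp, h⟩]
  · rcases this with h | h
    exacts [⟨_, by simp, h⟩, ⟨L, by simp, by simpa using h⟩]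

end LocAffine

/-- The coordinate functional. -/
abbrev coordL [Fintype ι] (l : ι) : (ι → ℝ) →L[ℝ] ℝ := ContinuousLinearMap.proj l

lemma coordL_ne_zero [Fintype ι] [DecidableEq ι] (l : ι) :
    (coordL l : (ι → ℝ) →L[ℝ] ℝ) ≠ 0 := by
  intro h
  have := DFunLike.congr_fun h (Pi.single l 1)
  simp at this

/-- A zigzag of slope `±1` and amplitude `2⁻ᵏ` on `[-1, 1]`. -/
def zigzag : ℕ → ℝ → ℝ
  | 0, s => |s|
  | k + 1, s => |zigzag k s - (2⁻¹ : ℝ) ^ (k + 1)|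

lemma zigzag_nonneg (k : ℕ) (s : ℝ) : 0 ≤ zigzag k s := by
  cases k <;> exact abs_nonneg _

lemma zigzag_neg (k : ℕ) (s : ℝ) : zigzag k (-s) = zigzag k s := by
  induction k with
  | zero => exact abs_neg s
  | succ k ih => simp only [zigzag, ih]

lemma zigzag_le (k : ℕ) {s : ℝ} (hs : |s| ≤ 1) : zigzag k s ≤ (2⁻¹ : ℝ) ^ k := by
  induction k with
  | zero => simpa [zigzag] using hs
  | succ k ih =>
    have h0 := zigzag_nonneg k s
    have : (2⁻¹ : ℝ) ^ k = 2 * 2⁻¹ ^ (k + 1) := by ring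
    simp only [zigzag]
    rw [abs_le]
    constructor <;> linarith

lemma lipschitzWith_zigzag (k : ℕ) : LipschitzWith 1 (zigzag k) := by
  induction k with
  | zero => exact lipschitzWith_one_norm (E := ℝ)
  | succ k ih =>
    have h : LipschitzWith 1 (fun s => zigzag k s - (2⁻¹ : ℝ) ^ (k + 1)) :=
      LipschitzWith.of_dist_le_mul fun x y => by simpa using ih.dist_le_mul x y
    simpa [zigzag, Function.comp_def] using (lipschitzWith_one_norm (E := ℝ)).comp h

lemma aeLocAffine_zigzag [Fintype ι] [DecidableEq ι] (j : ι) (k : ℕ) :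
    AELocAffine {coordL j, -coordL j} (fun x : ι → ℝ => zigzag k (x j)) := by
  induction k with
  | zero =>
    have h : AELocAffine {coordL j, -coordL j} (fun x : ι → ℝ => coordL j x) :=
      ae_of_all _ fun x => ⟨coordL j, by simp, isLocAffineAt_clm _ x⟩
    simpa [zigzag] using h.abs_sub (coordL_ne_zero j) 0
  | succ k ih => exact ih.abs_sub (coordL_ne_zero j) _

lemma aeLocAffine_norm [Fintype ι] [DecidableEq ι] [Nonempty ι] :
    AELocAffine {L | ∃ l, L = coordL l ∨ L = -coordL l} (fun x : ι → ℝ => ‖x‖) := by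
  have h1 : ∀ᵐ x : ι → ℝ, ∀ l, x l ≠ 0 := by
    rw [ae_all_iff]
    intro l
    have h : AELocAffine {coordL l} (fun x : ι → ℝ => coordL l x) :=
      ae_of_all _ fun x => ⟨coordL l, by simp, isLocAffineAt_clm _ x⟩
    exact h.ae_ne (by simpa using (coordL_ne_zero l).symm) 0
  have h2 : ∀ᵐ x : ι → ℝ, ∀ l m, l ≠ m → |x l| ≠ |x m| := by
    rw [ae_all_iff]; intro l
    rw [ae_all_iff]; intro m
    by_cases hlm : l = m
    · exact ae_of_all _ fun x h => (h hlm).elim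
    have hs : ∀ σ : ℝ, ∀ᵐ x : ι → ℝ, x l + σ * x m ≠ 0 := by
      intro σ
      have h : AELocAffine {coordL l + σ • coordL m}
          (fun x : ι → ℝ => (coordL l + σ • coordL m) x) :=
        ae_of_all _ fun x => ⟨_, rfl, isLocAffineAt_clm _ x⟩
      refine h.ae_ne ?_ 0
      intro h0
      have := DFunLike.congr_fun (show (0 : (ι → ℝ) →L[ℝ] ℝ) = _ from h0) (Pi.single l 1)
      simp [Ne.symm hlm] at this
    filter_upwards [hs 1, hs (-1)] with x hx hx' _ habs
    rcases abs_eq_abs.mp habs with h | h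
    · apply hx'; rw [h]; ring
    · apply hx; rw [h]; ring
  filter_upwards [h1, h2] with x hx1 hx2
  obtain ⟨l, -, hl⟩ := Finset.exists_max_image (Finset.univ : Finset ι) (fun i => |x i|)
    Finset.univ_nonempty
  have hlt : ∀ m, m ≠ l → |x m| < |x l| := fun m hm =>
    lt_of_le_of_ne (hl m (Finset.mem_univ m)) (hx2 m l hm)
  have hev : ∀ᶠ y : ι → ℝ in 𝓝 x, ∀ m, m ≠ l → |y m| < |y l| := by
    rw [eventually_all]
    intro m
    by_cases hm : m = l
    · exact Eventually.of_forall fun y h => (h hm).elim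
    · have c1 : ContinuousAt (fun y : ι → ℝ => |y m|) x := (continuous_apply m).abs.continuousAt
      have c2 : ContinuousAt (fun y : ι → ℝ => |y l|) x := (continuous_apply l).abs.continuousAt
      filter_upwards [c1.eventually_lt c2 (hlt m hm)] with y hy _ using hy
  have heq : (fun y : ι → ℝ => ‖y‖) =ᶠ[𝓝 x] fun y => |y l| := by
    filter_upwards [hev] with y hy
    apply le_antisymm
    · rw [pi_norm_le_iff_of_nonneg (abs_nonneg _)]
      intro m
      by_cases hm : m = l
      · rw [hm]; rfl
      · exact (hy m hm).le
    · exact norm_le_pi_norm y l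
  rcases (isLocAffineAt_clm (coordL l) x).abs (hx1 l) with h | h
  · exact ⟨_, ⟨l, Or.inl rfl⟩, h.congr heq⟩
  · exact ⟨_, ⟨l, Or.inr rfl⟩, h.congr heq⟩

/-- The scalar profile of a simple laminate on the unit cube: a zigzag in the direction `j`,
cut off near the boundary. -/
def profile [Fintype ι] (j : ι) (a b : ℝ) (k : ℕ) (x : ι → ℝ) : ℝ :=
  min (a * zigzag k (x j)) (b * max 0 (1 - ‖x‖))

section Profile

variable [Fintype ι] [DecidableEq ι] {j : ι} {a b : ℝ} {k : ℕ}

omit [DecidableEq ι] in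
lemma exists_lipschitz_profile (j : ι) (a b : ℝ) (k : ℕ) :
    ∃ C, LipschitzWith C (profile j a b k) := by
  have h1 : LipschitzWith _ (fun x : ι → ℝ => a * zigzag k (x j)) :=
    (LipschitzWith.of_dist_le_mul (K := ‖a‖₊) fun x y => by
      rw [Real.dist_eq, ← mul_sub, abs_mul]; rfl).comp
      ((lipschitzWith_zigzag k).comp (LipschitzWith.eval (α := fun _ : ι => ℝ) j))
  have h2 : LipschitzWith _ (fun x : ι → ℝ => b * max 0 (1 - ‖x‖)) :=
    (LipschitzWith.of_dist_le_mul (K := ‖b‖₊) fun x y => by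
      rw [Real.dist_eq, ← mul_sub, abs_mul]; rfl).comp
      (((LipschitzWith.const (1 : ℝ)).sub (lipschitzWith_one_norm (E := ι → ℝ))).const_max 0)
  exact ⟨_, h1.min h2⟩

omit [DecidableEq ι] in
lemma profile_eq_zero (ha : 0 ≤ a) {x : ι → ℝ} (hx : x ∉ Metric.ball (0 : ι → ℝ) 1) :
    profile j a b k x = 0 := by
  have h : 1 ≤ ‖x‖ := by simpa using hx
  rw [profile, max_eq_left (by linarith), mul_zero]
  exact min_eq_right (mul_nonneg ha (zigzag_nonneg _ _))

lemma ae_profile [Nonempty ι] (ha : 0 < a) (hb : 0 < b) (hab : a ≠ b) :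
    ∀ᵐ x : ι → ℝ, x ∈ Metric.ball (0 : ι → ℝ) 1 → ∃ L, IsLocAffineAt (profile j a b k) L x ∧
      ((L = a • coordL j ∨ L = -(a • coordL j)) ∨
        b * (1 - ‖x‖) ≤ a * zigzag k (x j) ∧ ∃ l, L = b • coordL l ∨ L = -(b • coordL l)) := by
  have hz : AELocAffine {a • coordL j, -(a • coordL j)}
      (fun x : ι → ℝ => a * zigzag k (x j)) := by
    filter_upwards [aeLocAffine_zigzag j k] with x hx
    obtain ⟨L, hL, hx⟩ := hx
    refine ⟨a • L, ?_, hx.const_mul a⟩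
    rcases hL with rfl | rfl <;> simp
  have hn : AELocAffine {L | ∃ l, L = b • coordL l ∨ L = -(b • coordL l)}
      (fun x : ι → ℝ => b * (1 - ‖x‖)) := by
    filter_upwards [aeLocAffine_norm (ι := ι)] with x hx
    obtain ⟨L, ⟨l, hl⟩, hx⟩ := hx
    refine ⟨b • (-L), ⟨l, ?_⟩, ((hx.sub_const 1).neg.const_mul b).congr
      (Eventually.of_forall fun y => by simp)⟩
    rcases hl with rfl | rfl <;> simp
  have hd : AELocAffine {L | L ≠ 0}
      (fun x : ι → ℝ => a * zigzag k (x j) - b * (1 - ‖x‖)) := by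
    filter_upwards [hz, hn] with x hx hx'
    obtain ⟨L, hL, hx⟩ := hx
    obtain ⟨M, ⟨l, hM⟩, hx'⟩ := hx'
    refine ⟨L - M, ?_, hx.sub hx'⟩
    intro h0
    have h1 := DFunLike.congr_fun h0 (Pi.single l 1)
    have hc : ∀ m n : ι, (Pi.single m (1 : ℝ) : ι → ℝ) n = 0 ∨
        (Pi.single m (1 : ℝ) : ι → ℝ) n = 1 := fun m n => by
      by_cases h : n = m
      · subst h; simp
      · simp [h]
    rcases hL with rfl | rfl <;> rcases hM with rfl | rfl <;>
      rcases hc l j with hc | hc <;> simp [hc] at h1 <;>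
      first
        | exact hb.ne' h1
        | exact hab (by linarith)
  filter_upwards [hz, hn, hd.ae_ne (by simp) 0] with x hx hx' hne hball
  obtain ⟨L, hL, hx⟩ := hx
  obtain ⟨M, hM, hx'⟩ := hx'
  have hball' : ∀ᶠ y : ι → ℝ in 𝓝 x, ‖y‖ < 1 := by
    filter_upwards [Metric.isOpen_ball.mem_nhds hball] with y hy
    simpa using hy
  rcases lt_or_gt_of_ne (sub_ne_zero.mp hne) with hlt | hlt
  · refine ⟨L, hx.congr ?_, Or.inl hL⟩
    filter_upwards [hx.continuousAt.eventually_lt hx'.continuousAt hlt, hball'] with y hy hy'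
    rw [profile, max_eq_right (by linarith)]
    exact min_eq_left hy.le
  · refine ⟨M, hx'.congr ?_, Or.inr ⟨hlt.le, hM⟩⟩
    filter_upwards [hx'.continuousAt.eventually_lt hx.continuousAt hlt, hball'] with y hy hy'
    rw [profile, max_eq_right (by linarith)]
    exact min_eq_right hy.le

lemma measurePreserving_reflection (j : ι) :
    MeasurePreserving (fun x : ι → ℝ => fun i => if i = j then -x i else x i) volume volume := by
  refine volume_preserving_pi (f := fun i => fun s : ℝ => if i = j then -s else s) fun i => ?_
  by_cases h : i = j
  · simpa [h] using Measure.measurePreserving_neg (volume : Measure ℝ)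
  · simpa [h] using! MeasurePreserving.id (volume : Measure ℝ)

lemma profile_reflection (x : ι → ℝ) :
    profile j a b k (fun i => if i = j then -x i else x i) = profile j a b k x := by
  have : ‖(fun i => if i = j then -x i else x i : ι → ℝ)‖ = ‖x‖ := by
    simp only [Pi.norm_def]
    congr 2
    ext i
    by_cases h : i = j <;> simp [h]
  simp [profile, this, zigzag_neg]

end Profile

section

variable [Fintype ι]

lemma IsLocAffineAt.eventually {h : (ι → ℝ) → ℝ} {L : (ι → ℝ) →L[ℝ] ℝ} {x : ι → ℝ}
    (hL : IsLocAffineAt h L x) : ∀ᶠ y in 𝓝 x, IsLocAffineAt h L y := by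
  filter_upwards [hL.eventually_nhds] with y hy
  filter_upwards [hy] with z hz
  rw [hz, hy.self_of_nhds, add_assoc, ← map_add]
  congr 2
  abel

lemma integral_mul_fderiv_eq_neg {h φ : (ι → ℝ) → ℝ} {C : NNReal} (hh : LipschitzWith C h)
    (hφ : ∀ n : ℕ, ContDiff ℝ n φ) (hc : HasCompactSupport φ) {g : (ι → ℝ) → ℝ} (w : ι → ℝ)
    (hg : ∀ᵐ x, φ x ≠ 0 → HasLineDerivAt ℝ h (g x) x w) :
    ∫ x, h x * fderiv ℝ φ x w = - ∫ x, g x * φ x := by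
  obtain ⟨D, hD⟩ := (hφ 1).lipschitzWith_of_hasCompactSupport hc (by simp)
  have h1 := LipschitzWith.integral_lineDeriv_mul_eq (μ := volume) hh hD hc w
  have h2 : ∫ x, lineDeriv ℝ h x w * φ x = ∫ x, g x * φ x := by
    apply integral_congr_ae
    filter_upwards [hg] with x hx
    by_cases h0 : φ x = 0
    · simp [h0]
    · simp only [(hx h0).lineDeriv]
  rw [← h2, h1, ← integral_neg]
  congr 1
  ext x
  have hd : DifferentiableAt ℝ φ x := ((hφ 1).differentiable (by simp)).differentiableAt
  rw [hd.lineDeriv_eq_fderiv, map_neg]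
  ring

lemma holder_of_lipschitz {h : (ι → ℝ) → ℝ} {C : NNReal} (hh : LipschitzWith C h)
    (h0 : ∀ x, x ∉ Metric.ball (0 : ι → ℝ) 1 → h x = 0) [Nonempty ι] {α : ℝ} (hα0 : 0 < α)
    (hα1 : α < 1) : ∃ K, 0 ≤ K ∧ ∀ x y, dist (h x) (h y) ≤ K * dist x y ^ α := by
  have hb : ∀ x, |h x| ≤ 2 * C := by
    intro x
    by_cases hx : x ∈ Metric.ball (0 : ι → ℝ) 1
    · have h1 := hh.dist_le_mul x (fun _ => 1)
      rw [h0 (fun _ => 1) (by simp [pi_norm_const]), Real.dist_0_eq_abs] at h1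
      have h2 : dist x (fun _ => 1) ≤ 2 := by
        have h3 : dist x (fun _ : ι => (1 : ℝ)) ≤ dist x 0 + dist 0 (fun _ : ι => (1 : ℝ)) :=
          dist_triangle _ _ _
        have h4 : dist (0 : ι → ℝ) (fun _ : ι => (1 : ℝ)) = 1 := by
          rw [dist_zero_left, pi_norm_const]; simp
        have h5 : dist x 0 < 1 := hx
        linarith
      calc |h x| ≤ C * dist x (fun _ => 1) := h1
        _ ≤ C * 2 := by gcongr
        _ = 2 * C := by ring
    · rw [h0 x hx]; simp
  refine ⟨4 * C, by positivity, fun x y => ?_⟩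
  rcases le_total (dist x y) 1 with hd | hd
  · have h1 : dist x y ≤ dist x y ^ α := by
      simpa using Real.rpow_le_rpow_of_exponent_ge' dist_nonneg hd hα0.le hα1.le
    calc dist (h x) (h y) ≤ C * dist x y := hh.dist_le_mul x y
      _ ≤ C * dist x y ^ α := by gcongr
      _ ≤ 4 * C * dist x y ^ α := by
        have : 0 ≤ (C : ℝ) * dist x y ^ α := by positivity
        linarith
  · have h1 : 1 ≤ dist x y ^ α := Real.one_le_rpow hd hα0.le
    calc dist (h x) (h y) ≤ |h x| + |h y| := by rw [Real.dist_eq]; exact abs_sub _ _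
      _ ≤ 4 * C * 1 := by linarith [hb x, hb y]
      _ ≤ 4 * C * dist x y ^ α := by gcongr

lemma exists_radius_near_one [Nonempty ι] {η : ℝ} (hη : 0 < η) : ∃ s : ℝ, 0 < s ∧ s < 1 ∧
    volume (Metric.ball (0 : ι → ℝ) 1 \ Metric.ball 0 s)
      ≤ ENNReal.ofReal η * volume (Metric.ball (0 : ι → ℝ) 1) := by
  set m := Module.finrank ℝ (ι → ℝ)
  have hc : ContinuousAt (fun s : ℝ => s ^ m) 1 := by fun_prop
  have h1 : ∀ᶠ s : ℝ in 𝓝 1, 1 - η < s ^ m :=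
    continuousAt_const.eventually_lt hc (by simpa using hη)
  obtain ⟨δ, hδ, hs⟩ := Metric.eventually_nhds_iff.mp h1
  have hm : 0 < min δ 1 := lt_min hδ one_pos
  have hm1 := min_le_left δ 1
  have hm2 := min_le_right δ 1
  refine ⟨1 - min δ 1 / 2, by linarith, by linarith, ?_⟩
  have h2 := @hs (1 - min δ 1 / 2) (by rw [Real.dist_eq, abs_lt]; constructor <;> linarith)
  rw [measure_sdiff (Metric.ball_subset_ball (by linarith)) measurableSet_ball.nullMeasurableSet
    measure_ball_lt_top.ne, Measure.addHaar_ball volume (0 : ι → ℝ) (r := 1 - min δ 1 / 2)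
    (by linarith), tsub_le_iff_right, ← add_mul, ← ENNReal.ofReal_add hη.le
    (pow_nonneg (by linarith) _)]
  refine le_mul_of_one_le_left zero_le ?_
  rw [← ENNReal.ofReal_one]
  exact ENNReal.ofReal_le_ofReal (by linarith)

end

/-! ### Admissible perturbations -/

/-- `v` is an `α`-Hölder map vanishing outside `D`, with bounded weak gradient `G`, and almost
everywhere in `D` it is locally affine. -/
structure Adm [Fintype ι] [DecidableEq ι] (α : ℝ) (D : Set (ι → ℝ)) (v : (ι → ℝ) → ι → ℝ)
    (G : (ι → ℝ) → Matrix ι ι ℝ) : Prop where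
  holder : ∃ C, 0 ≤ C ∧ ∀ x y, dist (v x) (v y) ≤ C * dist x y ^ α
  zero : ∀ x, x ∉ D → v x = 0
  grad_zero : ∀ x, x ∉ D → G x = 0
  bdd : ∃ K, ∀ x k l, |G x k l| ≤ K
  meas : ∀ k l, AEMeasurable (fun x => G x k l) volume
  locAffine : ∀ᵐ x, x ∈ D → ∃ ρ > 0, ∀ y ∈ Metric.closedBall x ρ,
    G y = G x ∧ v y = v x + (G x).mulVec (y - x)
  weak : ∀ φ : (ι → ℝ) → ℝ, (∀ n : ℕ, ContDiff ℝ n φ) → HasCompactSupport φ → ∀ k l,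
    ∫ x, v x k * fderiv ℝ φ x (Pi.single l 1) = - ∫ x, G x k l * φ x

/-- The matrix whose `i`-th row is `L` and whose other rows vanish. -/
def rowMatrix [Fintype ι] [DecidableEq ι] (i : ι) (L : (ι → ℝ) →L[ℝ] ℝ) : Matrix ι ι ℝ :=
  fun k l => if k = i then L (Pi.single l 1) else 0

section

variable [Fintype ι] [DecidableEq ι]

lemma rowMatrix_smul_coordL (i j : ι) (a : ℝ) :
    rowMatrix i (a • coordL j) = Matrix.single i j a := by
  ext k l
  simp only [rowMatrix, Matrix.single_apply, eq_comm (a := i), eq_comm (a := j)]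
  by_cases hk : k = i <;> by_cases hl : l = j <;> simp [hk, hl]

lemma rowMatrix_neg (i : ι) (L : (ι → ℝ) →L[ℝ] ℝ) : rowMatrix i (-L) = -rowMatrix i L := by
  ext k l
  by_cases hk : k = i <;> simp [rowMatrix, hk]

lemma rowMatrix_neg_smul_coordL (i j : ι) (a : ℝ) :
    rowMatrix i (-(a • coordL j)) = Matrix.single i j (-a) := by
  rw [rowMatrix_neg, rowMatrix_smul_coordL, ← Matrix.single_neg]

lemma rowMatrix_mulVec (i : ι) (L : (ι → ℝ) →L[ℝ] ℝ) (w : ι → ℝ) :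
    (rowMatrix i L).mulVec w = Pi.single i (L w) := by
  ext k
  by_cases hk : k = i
  · subst hk
    simp only [Matrix.mulVec, dotProduct, rowMatrix, if_true, Pi.single_eq_same]
    conv_rhs => rw [← Finset.univ_sum_single w, map_sum]
    refine Finset.sum_congr rfl fun l _ => ?_
    rw [mul_comm, ← smul_eq_mul, ← map_smul, ← Pi.single_smul]
    simp
  · simp [Matrix.mulVec, dotProduct, rowMatrix, hk]

lemma abs_rowMatrix_le {b τ : ℝ} (hb : 0 < b) (hbτ : b ≤ τ) {L : (ι → ℝ) →L[ℝ] ℝ}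
    (hL : ∃ l, L = b • coordL l ∨ L = -(b • coordL l)) (i k m : ι) :
    |rowMatrix i L k m| ≤ τ := by
  have key : ∀ l, |Matrix.single i l b k m| ≤ τ := fun l => by
    rw [Matrix.single_apply]
    split_ifs
    · rwa [abs_of_pos hb]
    · simpa using hb.le.trans hbτ
  obtain ⟨l, rfl | rfl⟩ := hL
  · rw [rowMatrix_smul_coordL]; exact key l
  · rw [rowMatrix_neg, rowMatrix_smul_coordL, Matrix.neg_apply, abs_neg]; exact key l

lemma Adm.zero_zero {α : ℝ} (D : Set (ι → ℝ)) : Adm α D (0 : (ι → ℝ) → ι → ℝ) 0 where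
  holder := ⟨0, le_rfl, by simp⟩
  zero := by simp
  grad_zero := by simp
  bdd := ⟨0, by simp⟩
  meas k l := by simp
  locAffine := ae_of_all _ fun x _ => ⟨1, one_pos, by simp⟩
  weak := by simp

variable [Nonempty ι]

/-- Simple laminates: a perturbation of the zero map whose gradient takes the values
`± a eᵢ ⊗ eⱼ` on at most half of the cube each, up to a small set where it is small. -/
lemma exists_split {α : ℝ} (hα0 : 0 < α) (hα1 : α < 1) (i j : ι) {a τ η : ℝ} (ha : 0 < a)
    (hτ : 0 < τ) (hη : 0 < η) :
    ∃ (v : (ι → ℝ) → ι → ℝ) (G : (ι → ℝ) → Matrix ι ι ℝ) (P N : Set (ι → ℝ)),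
      Adm α (Metric.ball 0 1) v G ∧ MeasurableSet P ∧ MeasurableSet N ∧
      P ⊆ Metric.ball 0 1 ∧ N ⊆ Metric.ball 0 1 ∧
      2 * volume P ≤ volume (Metric.ball (0 : ι → ℝ) 1) ∧
      2 * volume N ≤ volume (Metric.ball (0 : ι → ℝ) 1) ∧
      volume (Metric.ball (0 : ι → ℝ) 1 \ (P ∪ N))
        ≤ ENNReal.ofReal η * volume (Metric.ball (0 : ι → ℝ) 1) ∧
      (∀ x ∈ P, G x = Matrix.single i j a) ∧ (∀ x ∈ N, G x = Matrix.single i j (-a)) ∧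
      ∀ x, G x = Matrix.single i j a ∨ G x = Matrix.single i j (-a) ∨ ∀ k l, |G x k l| ≤ τ := by
  classical
  obtain ⟨b, hb, hbτ, hab⟩ : ∃ b, 0 < b ∧ b ≤ τ ∧ a ≠ b := by
    by_cases h : a = τ
    · exact ⟨τ / 2, by linarith, by linarith, by linarith⟩
    · exact ⟨τ, hτ, le_rfl, h⟩
  obtain ⟨s, hs0, hs1, hs⟩ := exists_radius_near_one (ι := ι) hη
  obtain ⟨k, hk⟩ : ∃ k : ℕ, a * (2⁻¹ : ℝ) ^ k < b * (1 - s) := by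
    obtain ⟨k, hk⟩ := exists_pow_lt_of_lt_one (show 0 < b * (1 - s) / a from
      div_pos (mul_pos hb (by linarith)) ha) (show (2⁻¹ : ℝ) < 1 by norm_num)
    exact ⟨k, by rwa [lt_div_iff₀ ha, mul_comm] at hk⟩
  set h := profile j a b k with hh
  obtain ⟨C, hC⟩ := exists_lipschitz_profile j a b k
  have hcj : a • (coordL j : (ι → ℝ) →L[ℝ] ℝ) ≠ 0 := smul_ne_zero ha.ne' (coordL_ne_zero j)
  set B := Metric.ball (0 : ι → ℝ) 1 with hB
  set A1 : Set ((ι → ℝ) →L[ℝ] ℝ) := {L | L = a • coordL j ∨ L = -(a • coordL j)} with hA1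
  set A2 : Set ((ι → ℝ) →L[ℝ] ℝ) := {L | ∃ l, L = b • coordL l ∨ L = -(b • coordL l)} with hA2
  set P := {x | x ∈ B ∧ fderiv ℝ h x = a • coordL j} with hP
  set N := {x | x ∈ B ∧ fderiv ℝ h x = -(a • coordL j)} with hN
  have hPm : MeasurableSet P :=
    measurableSet_ball.inter (measurable_fderiv ℝ h (measurableSet_singleton _))
  have hNm : MeasurableSet N :=
    measurableSet_ball.inter (measurable_fderiv ℝ h (measurableSet_singleton _))
  set R : (ι → ℝ) →L[ℝ] (ι → ℝ) :=
    ContinuousLinearMap.pi fun l => if l = j then -coordL l else coordL l with hR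
  have hRx : ∀ x, R x = fun l => if l = j then -x l else x l := by
    intro x; ext l; by_cases hl : l = j <;> simp [hR, hl]
  have hRmp : MeasurePreserving R volume volume := by
    have : (R : (ι → ℝ) → ι → ℝ) = fun x l => if l = j then -x l else x l := funext hRx
    rw [this]; exact measurePreserving_reflection j
  have hRball : ∀ x, R x ∈ B → x ∈ B := by
    intro x hx
    have hx' : ‖R x‖ < 1 := by simpa [hB] using hx
    have : ‖x‖ < 1 := by
      rw [pi_norm_lt_iff one_pos] at hx' ⊢
      intro l
      have := hx' l
      rw [hRx] at this
      by_cases hl : l = j <;> simpa [hl] using this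
    simpa [hB] using this
  have hRd : ∀ x L, L ≠ 0 → fderiv ℝ h (R x) = L → fderiv ℝ h x = L.comp R := by
    intro x L hL0 hL
    have hd : DifferentiableAt ℝ h (R x) := by
      by_contra hd
      exact hL0 (hL ▸ fderiv_zero_of_not_differentiableAt hd)
    have h1 : HasFDerivAt (h ∘ R) (L.comp R) x := (hL ▸ hd.hasFDerivAt).comp x R.hasFDerivAt
    have h2 : h ∘ R = h := by
      ext y; simp only [Function.comp_apply, hRx]; exact profile_reflection y
    rw [h2] at h1
    exact h1.fderiv
  have hcR : (coordL j : (ι → ℝ) →L[ℝ] ℝ).comp R = -coordL j := by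
    ext x; simp [hRx]
  have hPN : volume P ≤ volume N := by
    rw [← hRmp.measure_preimage hPm.nullMeasurableSet]
    refine measure_mono fun x hx => ⟨hRball x hx.1, ?_⟩
    rw [hRd x _ hcj hx.2, ContinuousLinearMap.smul_comp, hcR, smul_neg]
  have hNP : volume N ≤ volume P := by
    rw [← hRmp.measure_preimage hNm.nullMeasurableSet]
    refine measure_mono fun x hx => ⟨hRball x hx.1, ?_⟩
    rw [hRd x _ (neg_ne_zero.mpr hcj) hx.2, ContinuousLinearMap.neg_comp,
      ContinuousLinearMap.smul_comp, hcR, smul_neg, neg_neg]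
  have hsum : volume P + volume N ≤ volume B := by
    rw [← measure_union _ hNm]
    · exact measure_mono (union_subset (fun x hx => hx.1) fun x hx => hx.1)
    · rw [disjoint_left]
      intro x hx hx'
      have h1 := hx.2.symm.trans hx'.2
      have h2 := congrArg (fun L : (ι → ℝ) →L[ℝ] ℝ => L (Pi.single j 1)) h1
      simp [coordL] at h2
      linarith
  have hae := ae_profile (j := j) (k := k) ha hb hab
  set G : (ι → ℝ) → Matrix ι ι ℝ := fun x =>
    if x ∈ B ∧ fderiv ℝ h x ∈ A1 ∪ A2 then rowMatrix i (fderiv ℝ h x) else 0 with hG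
  have hzero : ∀ x, x ∉ B → h x = 0 := fun x hx => profile_eq_zero ha.le hx
  have hGL : ∀ᵐ x, x ∈ B → ∃ L ∈ A1 ∪ A2, IsLocAffineAt h L x ∧ G x = rowMatrix i L := by
    filter_upwards [hae] with x hx hxB
    obtain ⟨L, hL, hL'⟩ := hx hxB
    have hmem : L ∈ A1 ∪ A2 := hL'.elim Or.inl fun h => Or.inr h.2
    have hd : fderiv ℝ h x = L := hL.hasFDerivAt.fderiv
    refine ⟨L, hmem, hL, ?_⟩
    simp only [hG, hd]
    rw [if_pos ⟨hxB, hmem⟩]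
  have hmeasset : MeasurableSet {x | x ∈ B ∧ fderiv ℝ h x ∈ A1 ∪ A2} := by
    refine measurableSet_ball.inter (measurable_fderiv ℝ h (MeasurableSet.union ?_ ?_))
    · exact (Set.toFinite {a • coordL j, -(a • coordL j)}).measurableSet
    · have : A2 = ⋃ l, {b • coordL l, -(b • coordL l)} := by ext; simp [hA2]
      rw [this]
      exact (Set.finite_iUnion fun l => Set.toFinite _).measurableSet
  refine ⟨fun x => Pi.single i (h x), G, P, N, ?_, hPm, hNm, fun x hx => hx.1, fun x hx => hx.1,
    ?_, ?_, ?_, ?_, ?_, ?_⟩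
  · constructor
    · obtain ⟨K, hK0, hK⟩ := holder_of_lipschitz hC hzero hα0 hα1
      refine ⟨K, hK0, fun x y => ?_⟩
      rw [dist_pi_le_iff (by positivity)]
      intro l
      by_cases hl : l = i
      · subst hl; simpa using hK x y
      · simp [hl]; positivity
    · intro x hx
      simp [hzero x hx]
    · intro x hx
      simp [hG, hx]
    · refine ⟨max a τ, fun x k' l => ?_⟩
      simp only [hG]
      split_ifs with hx
      · rcases hx.2 with h1 | h1
        · exact abs_rowMatrix_le ha (le_max_left _ _) ⟨j, h1⟩ i k' l
        · exact abs_rowMatrix_le hb (hbτ.trans (le_max_right _ _)) h1 i k' l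
      · simp [ha.le]
    · intro k' l
      have : (fun x => G x k' l) = indicator {x | x ∈ B ∧ fderiv ℝ h x ∈ A1 ∪ A2}
          (fun x => if k' = i then fderiv ℝ h x (Pi.single l 1) else 0) := by
        ext x
        simp only [hG, indicator, mem_ofPred_eq]
        split_ifs with h1 <;> simp_all [rowMatrix]
      rw [this]
      refine (Measurable.indicator ?_ hmeasset).aemeasurable
      by_cases hk' : k' = i
      · simp only [hk', if_true]
        exact measurable_fderiv_apply_const ℝ h _
      · simp [hk']
    · filter_upwards [hGL] with x hx hxB
      obtain ⟨L, hLA, hL, hGx⟩ := hx hxB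
      have hev : ∀ᶠ y in 𝓝 x, IsLocAffineAt h L y ∧ h y = h x + L (y - x) ∧ y ∈ B :=
        hL.eventually.and (hL.and (Metric.isOpen_ball.mem_nhds hxB))
      obtain ⟨ρ, hρ, hρ'⟩ := Metric.nhds_basis_closedBall.eventually_iff.mp hev
      refine ⟨ρ, hρ, fun y hy => ?_⟩
      obtain ⟨h1, h2, h3⟩ := hρ' hy
      constructor
      · rw [hGx, hG]
        simp only [h1.hasFDerivAt.fderiv]
        rw [if_pos ⟨h3, hLA⟩]
      · rw [hGx, rowMatrix_mulVec, h2, Pi.single_add]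
    · intro φ hφ hc k' l
      by_cases hk' : k' = i
      · subst hk'
        simp only [Pi.single_eq_same]
        refine integral_mul_fderiv_eq_neg hC hφ hc _ ?_
        have hsph : ∀ᵐ x : ι → ℝ, x ∉ Metric.sphere (0 : ι → ℝ) 1 :=
          measure_eq_zero_iff_ae_notMem.mp (Measure.addHaar_sphere volume _ _)
        filter_upwards [hGL, hsph] with x hx hxs _
        by_cases hxB : x ∈ B
        · obtain ⟨L, -, hL, hGx⟩ := hx hxB
          have := hL.hasFDerivAt.hasLineDerivAt (Pi.single l 1)
          rw [hGx]
          simpa [rowMatrix] using this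
        · have h0 : G x = 0 := by simp [hG, hxB]
          have hx1 : (1 : ℝ) < ‖x‖ := by
            have h1 : 1 ≤ ‖x‖ := by simpa [hB] using hxB
            exact lt_of_le_of_ne h1 fun h => hxs (by simp [← h])
          have hev : h =ᶠ[𝓝 x] fun _ => 0 := by
            filter_upwards [continuousAt_const.eventually_lt continuous_norm.continuousAt hx1]
              with y hy
            exact hzero y (by simpa [hB] using hy.le)
          have h1 : HasFDerivAt h (0 : (ι → ℝ) →L[ℝ] ℝ) x :=
            (hasFDerivAt_const (0 : ℝ) x).congr_of_eventuallyEq hev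
          rw [h0]
          simpa using h1.hasLineDerivAt (Pi.single l 1)
      · have h0 : ∀ x, G x k' l = 0 := fun x => by
          simp only [hG]; split_ifs <;> simp [rowMatrix, hk']
        simp [h0, hk']
  · calc 2 * volume P = volume P + volume P := two_mul _
      _ ≤ volume P + volume N := by gcongr
      _ ≤ volume B := hsum
  · calc 2 * volume N = volume N + volume N := two_mul _
      _ ≤ volume P + volume N := by gcongr
      _ ≤ volume B := hsum
  · refine (measure_mono_ae ?_).trans hs
    filter_upwards [hae] with x hx hxm
    obtain ⟨hxB, hxn⟩ := hxm
    obtain ⟨L, hL, hL'⟩ := hx hxB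
    refine ⟨hxB, ?_⟩
    rcases hL' with h1 | ⟨h1, -⟩
    · refine (hxn ?_).elim
      rcases h1 with h1 | h1
      · exact Or.inl ⟨hxB, hL.hasFDerivAt.fderiv.trans h1⟩
      · exact Or.inr ⟨hxB, hL.hasFDerivAt.fderiv.trans h1⟩
    · have hx1 : ‖x‖ < 1 := by simpa [hB] using hxB
      have h2 : |x j| ≤ 1 := (norm_le_pi_norm x j).trans hx1.le
      have h3 : a * zigzag k (x j) ≤ a * (2⁻¹ : ℝ) ^ k := by gcongr; exact zigzag_le k h2
      have h4 : b * (1 - ‖x‖) < b * (1 - s) := by linarith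
      have h5 := lt_of_mul_lt_mul_left h4 hb.le
      have : s ≤ ‖x‖ := by linarith
      simpa using this
  · rintro x ⟨hxB, hx⟩
    simp only [hG, hx]
    rw [if_pos ⟨hxB, Or.inl (Or.inl rfl)⟩, rowMatrix_smul_coordL]
  · rintro x ⟨hxB, hx⟩
    simp only [hG, hx]
    rw [if_pos ⟨hxB, Or.inl (Or.inr rfl)⟩, rowMatrix_neg_smul_coordL]
  · intro x
    simp only [hG]
    split_ifs with hx
    · rcases hx.2 with h1 | h1
      · rcases h1 with h1 | h1
        · left; rw [h1, rowMatrix_smul_coordL]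
        · right; left; rw [h1, rowMatrix_neg_smul_coordL]
      · right; right; exact abs_rowMatrix_le hb hbτ h1 i
    · right; right; simp [hτ.le]

end

section

variable [Fintype ι]

/-! ### Rescaling -/

lemma map_rescale (c : ι → ℝ) {ρ : ℝ} (hρ : 0 < ρ) :
    Measure.map (fun x : ι → ℝ => ρ⁻¹ • (x - c)) volume
      = ENNReal.ofReal (ρ ^ Module.finrank ℝ (ι → ℝ)) • (volume : Measure (ι → ℝ)) := by
  have h1 : (fun x : ι → ℝ => ρ⁻¹ • (x - c)) = (fun x => ρ⁻¹ • x) ∘ (fun x => x - c) := rfl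
  rw [h1, ← Measure.map_map (by fun_prop) (by fun_prop), map_sub_right_eq_self,
    Measure.map_addHaar_smul _ (inv_ne_zero hρ.ne')]
  congr 2
  rw [inv_pow, inv_inv, abs_of_pos (by positivity)]

lemma measurableEmbedding_rescale (c : ι → ℝ) {ρ : ℝ} (hρ : 0 < ρ) :
    MeasurableEmbedding (fun x : ι → ℝ => ρ⁻¹ • (x - c)) := by
  have h : (fun x : ι → ℝ => ρ⁻¹ • (x - c)) =
      (Homeomorph.subRight c).trans (Homeomorph.smulOfNeZero ρ⁻¹ (inv_ne_zero hρ.ne')) := rfl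
  rw [h]
  exact Homeomorph.measurableEmbedding _

lemma ae_rescale (c : ι → ℝ) {ρ : ℝ} (hρ : 0 < ρ) {p : (ι → ℝ) → Prop} (h : ∀ᵐ z, p z) :
    ∀ᵐ x, p (ρ⁻¹ • (x - c)) := by
  have h2 : ∀ᵐ z ∂(Measure.map (fun x : ι → ℝ => ρ⁻¹ • (x - c)) volume), p z := by
    rw [map_rescale c hρ]
    exact Measure.ae_smul_measure h _
  exact ae_of_ae_map (measurableEmbedding_rescale c hρ).measurable.aemeasurable h2

lemma integral_rescale (c : ι → ℝ) {ρ : ℝ} (hρ : 0 < ρ) (g : (ι → ℝ) → ℝ) :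
    ∫ x, g (ρ⁻¹ • (x - c)) = ρ ^ Module.finrank ℝ (ι → ℝ) * ∫ z, g z := by
  rw [← (measurableEmbedding_rescale c hρ).integral_map, map_rescale c hρ, integral_smul_measure,
    ENNReal.toReal_ofReal (by positivity), smul_eq_mul]

lemma rescale_mem_ball {c x : ι → ℝ} {ρ : ℝ} (hρ : 0 < ρ) :
    ρ⁻¹ • (x - c) ∈ Metric.ball (0 : ι → ℝ) 1 ↔ x ∈ Metric.ball c ρ := by
  rw [mem_ball_zero_iff, mem_ball_iff_norm, norm_smul, norm_inv, Real.norm_of_nonneg hρ.le,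
    inv_mul_lt_iff₀ hρ, mul_one]

lemma setLIntegral_rescale (c : ι → ℝ) {ρ : ℝ} (hρ : 0 < ρ) (g : (ι → ℝ) → ENNReal) :
    ∫⁻ x in Metric.ball c ρ, g (ρ⁻¹ • (x - c))
      = ENNReal.ofReal (ρ ^ Module.finrank ℝ (ι → ℝ)) * ∫⁻ z in Metric.ball 0 1, g z := by
  have hb : Metric.ball c ρ = (fun x : ι → ℝ => ρ⁻¹ • (x - c)) ⁻¹' Metric.ball 0 1 := by
    ext x; exact (rescale_mem_ball hρ).symm
  rw [hb, ← lintegral_indicator ((measurableEmbedding_rescale c hρ).measurable measurableSet_ball),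
    ← lintegral_indicator measurableSet_ball]
  have := (measurableEmbedding_rescale c hρ).lintegral_map
    (μ := volume) (indicator (Metric.ball 0 1) g)
  rw [map_rescale c hρ, lintegral_smul_measure] at this
  exact this.symm

lemma rescale_holder {α : ℝ} {w : (ι → ℝ) → ι → ℝ} {C : ℝ}
    (hC : ∀ x y, dist (w x) (w y) ≤ C * dist x y ^ α) (c : ι → ℝ) {ρ : ℝ} (hρ : 0 < ρ)
    (x y : ι → ℝ) :
    dist (ρ • w (ρ⁻¹ • (x - c))) (ρ • w (ρ⁻¹ • (y - c))) ≤ ρ ^ (1 - α) * C * dist x y ^ α := by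
  have h1 : dist (ρ⁻¹ • (x - c)) (ρ⁻¹ • (y - c)) = ρ⁻¹ * dist x y := by
    rw [dist_smul₀, norm_inv, Real.norm_of_nonneg hρ.le, dist_sub_right]
  rw [dist_smul₀, Real.norm_of_nonneg hρ.le]
  calc ρ * dist (w (ρ⁻¹ • (x - c))) (w (ρ⁻¹ • (y - c)))
      ≤ ρ * (C * (ρ⁻¹ * dist x y) ^ α) := by
        gcongr; rw [← h1]; exact hC _ _
    _ = ρ ^ (1 - α) * C * dist x y ^ α := by
        rw [Real.mul_rpow (by positivity) dist_nonneg, Real.inv_rpow hρ.le, Real.rpow_sub hρ,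
          Real.rpow_one]
        ring

lemma continuous_of_holder {α : ℝ} (hα : 0 < α) {v : (ι → ℝ) → ι → ℝ} {C : ℝ}
    (hC : ∀ x y, dist (v x) (v y) ≤ C * dist x y ^ α) : Continuous v := by
  refine continuous_iff_continuousAt.mpr fun x => tendsto_iff_dist_tendsto_zero.mpr ?_
  have h1 : Continuous fun y : ι → ℝ => C * dist y x ^ α :=
    continuous_const.mul ((continuous_id.dist continuous_const).rpow_const fun _ => Or.inr hα.le)
  have h2 := h1.tendsto x
  simp only [dist_self, Real.zero_rpow hα.ne', mul_zero] at h2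
  exact squeeze_zero (fun _ => dist_nonneg) (fun y => hC y x) h2

lemma integrable_fderiv_apply {φ : (ι → ℝ) → ℝ} (hφ : ∀ n : ℕ, ContDiff ℝ n φ)
    (hc : HasCompactSupport φ) (w : ι → ℝ) :
    Continuous (fun x => fderiv ℝ φ x w) ∧ HasCompactSupport (fun x => fderiv ℝ φ x w) :=
  ⟨((hφ 1).continuous_fderiv (by simp)).clm_apply continuous_const, hc.fderiv_apply ℝ w⟩

lemma integrable_mul_of_bdd {g φ : (ι → ℝ) → ℝ} (hg : AEMeasurable g) {K : ℝ}
    (hK : ∀ x, |g x| ≤ K) (hφ : Continuous φ) (hc : HasCompactSupport φ) :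
    Integrable (fun x => g x * φ x) :=
  (hφ.integrable_of_hasCompactSupport hc).bdd_mul (c := K) hg.aestronglyMeasurable
    (ae_of_all _ hK)

lemma integrable_mul_of_continuous {g φ : (ι → ℝ) → ℝ} (hg : Continuous g)
    (hφ : Continuous φ) (hc : HasCompactSupport φ) : Integrable (fun x => g x * φ x) :=
  (hg.mul hφ).integrable_of_hasCompactSupport hc.mul_left

end

section

variable [Fintype ι] [DecidableEq ι]

lemma Adm.rescale {α : ℝ} {w : (ι → ℝ) → ι → ℝ} {H : (ι → ℝ) → Matrix ι ι ℝ}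
    (h : Adm α (Metric.ball 0 1) w H) (c : ι → ℝ) {ρ : ℝ} (hρ : 0 < ρ) :
    Adm α (Metric.ball c ρ) (fun x => ρ • w (ρ⁻¹ • (x - c))) (fun x => H (ρ⁻¹ • (x - c))) where
  holder := by
    obtain ⟨C, hC0, hC⟩ := h.holder
    exact ⟨ρ ^ (1 - α) * C, by positivity, rescale_holder hC c hρ⟩
  zero x hx := by
    rw [h.zero _ (fun hx' => hx ((rescale_mem_ball hρ).mp hx')), smul_zero]
  grad_zero x hx := h.grad_zero _ (fun hx' => hx ((rescale_mem_ball hρ).mp hx'))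
  bdd := by
    obtain ⟨K, hK⟩ := h.bdd
    exact ⟨K, fun x => hK _⟩
  meas k l := by
    have h1 : AEMeasurable (fun z => H z k l)
        (Measure.map (fun x : ι → ℝ => ρ⁻¹ • (x - c)) volume) := by
      rw [map_rescale c hρ]
      exact (h.meas k l).smul_measure _
    exact h1.comp_measurable (measurableEmbedding_rescale c hρ).measurable
  locAffine := by
    filter_upwards [ae_rescale c hρ h.locAffine] with x hx hxB
    obtain ⟨σ, hσ, hσ'⟩ := hx ((rescale_mem_ball hρ).mpr hxB)
    refine ⟨ρ * σ, by positivity, fun y hy => ?_⟩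
    obtain ⟨h1, h2⟩ := hσ' (ρ⁻¹ • (y - c)) (by
      rw [Metric.mem_closedBall, dist_smul₀, norm_inv, Real.norm_of_nonneg hρ.le, dist_sub_right,
        inv_mul_le_iff₀ hρ]
      exact hy)
    refine ⟨h1, ?_⟩
    rw [h2, ← smul_sub, sub_sub_sub_cancel_right, Matrix.mulVec_smul, smul_add, smul_smul,
      mul_inv_cancel₀ hρ.ne', one_smul]
  weak φ hφ hc k l := by
    set ψ : (ι → ℝ) → ℝ := fun z => φ (ρ • z + c) with hψ
    have hψs : ∀ n : ℕ, ContDiff ℝ n ψ := fun n => (hφ n).comp (by fun_prop)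
    have hψc : HasCompactSupport ψ := by
      have : ψ = φ ∘ ((Homeomorph.smulOfNeZero ρ hρ.ne').trans (Homeomorph.addRight c)) := rfl
      rw [this]
      exact hc.comp_homeomorph _
    have hfd : ∀ z, fderiv ℝ ψ z (Pi.single l 1) = ρ * fderiv ℝ φ (ρ • z + c) (Pi.single l 1) := by
      intro z
      have h1 : HasFDerivAt (fun z : ι → ℝ => ρ • z + c) (ρ • ContinuousLinearMap.id ℝ (ι → ℝ)) z :=
        ((hasFDerivAt_id z).const_smul ρ).add_const c
      have h2 : HasFDerivAt φ (fderiv ℝ φ (ρ • z + c)) (ρ • z + c) :=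
        (((hφ 1).differentiable (by simp)) _).hasFDerivAt
      have h3 := (h2.comp z h1).fderiv
      have h4 : fderiv ℝ ψ z = fderiv ℝ (φ ∘ fun z => ρ • z + c) z := rfl
      rw [h4, h3]
      simp
    have hinv : ∀ x : ι → ℝ, ρ • (ρ⁻¹ • (x - c)) + c = x := fun x => by
      rw [smul_smul, mul_inv_cancel₀ hρ.ne', one_smul, sub_add_cancel]
    have e1 : ∫ x, (ρ • w (ρ⁻¹ • (x - c))) k * fderiv ℝ φ x (Pi.single l 1)
        = ∫ x, (fun z => w z k * fderiv ℝ ψ z (Pi.single l 1)) (ρ⁻¹ • (x - c)) := by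
      congr 1
      ext x
      simp only [hfd, hinv, Pi.smul_apply, smul_eq_mul]
      ring
    have e2 : ∫ x, H (ρ⁻¹ • (x - c)) k l * φ x
        = ∫ x, (fun z => H z k l * ψ z) (ρ⁻¹ • (x - c)) := by
      congr 1
      ext x
      simp only [hψ, hinv]
    exact (e1.trans (integral_rescale c hρ fun z => w z k * fderiv ℝ ψ z (Pi.single l 1))).trans (by
      rw [e2.trans (integral_rescale c hρ fun z => H z k l * ψ z), h.weak ψ hψs hψc k l, mul_neg])

/-! ### Integrability of admissible perturbations -/

lemma Adm.continuous {α : ℝ} (hα : 0 < α) {D : Set (ι → ℝ)} {v : (ι → ℝ) → ι → ℝ}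
    {G : (ι → ℝ) → Matrix ι ι ℝ} (h : Adm α D v G) : Continuous v := by
  obtain ⟨C, -, hC⟩ := h.holder
  exact continuous_of_holder hα hC

lemma Adm.add {α : ℝ} (hα : 0 < α) {D : Set (ι → ℝ)} {v w : (ι → ℝ) → ι → ℝ}
    {G H : (ι → ℝ) → Matrix ι ι ℝ} (hv : Adm α D v G) (hw : Adm α D w H) :
    Adm α D (fun x => v x + w x) (fun x => G x + H x) where
  holder := by
    obtain ⟨C, hC0, hC⟩ := hv.holder
    obtain ⟨C', hC0', hC'⟩ := hw.holder
    refine ⟨C + C', by positivity, fun x y => ?_⟩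
    rw [add_mul]
    exact (dist_add_add_le _ _ _ _).trans (add_le_add (hC x y) (hC' x y))
  zero x hx := by simp [hv.zero x hx, hw.zero x hx]
  grad_zero x hx := by simp [hv.grad_zero x hx, hw.grad_zero x hx]
  bdd := by
    obtain ⟨C, hC⟩ := hv.bdd
    obtain ⟨C', hC'⟩ := hw.bdd
    exact ⟨C + C', fun x k l => (abs_add_le _ _).trans (add_le_add (hC x k l) (hC' x k l))⟩
  meas k l := (hv.meas k l).add (hw.meas k l)
  locAffine := by
    filter_upwards [hv.locAffine, hw.locAffine] with x h1 h2 hx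
    obtain ⟨ρ, hρ, h1⟩ := h1 hx
    obtain ⟨σ, hσ, h2⟩ := h2 hx
    refine ⟨min ρ σ, lt_min hρ hσ, fun y hy => ?_⟩
    obtain ⟨h3, h4⟩ := h1 y (Metric.closedBall_subset_closedBall (min_le_left _ _) hy)
    obtain ⟨h5, h6⟩ := h2 y (Metric.closedBall_subset_closedBall (min_le_right _ _) hy)
    refine ⟨by rw [h3, h5], ?_⟩
    rw [h4, h6, Matrix.add_mulVec]
    abel
  weak φ hφ hc k l := by
    obtain ⟨h1, h2⟩ := integrable_fderiv_apply hφ hc (Pi.single l 1)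
    have hφ0 : Continuous φ := (hφ 0).continuous
    obtain ⟨K, hK⟩ := hv.bdd
    obtain ⟨K', hK'⟩ := hw.bdd
    have i1 := integrable_mul_of_continuous (continuous_pi_iff.mp (hv.continuous hα) k) h1 h2
    have i2 := integrable_mul_of_continuous (continuous_pi_iff.mp (hw.continuous hα) k) h1 h2
    have i3 := integrable_mul_of_bdd (hv.meas k l) (fun x => hK x k l) hφ0 hc
    have i4 := integrable_mul_of_bdd (hw.meas k l) (fun x => hK' x k l) hφ0 hc
    simp only [Pi.add_apply, Matrix.add_apply, add_mul]
    rw [integral_add i1 i2, integral_add i3 i4, hv.weak φ hφ hc k l, hw.weak φ hφ hc k l, neg_add]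

end

section

variable [Fintype ι] [DecidableEq ι]

/-- Gluing admissible perturbations supported in disjoint balls. -/
lemma Adm.glue {α : ℝ} (hα : 0 < α) {D : Set (ι → ℝ)} {t : Set (ι → ℝ)} (ht : t.Countable)
    {r : (ι → ℝ) → ℝ} (hr : ∀ c ∈ t, 0 < r c)
    (hdisj : t.PairwiseDisjoint fun c => Metric.closedBall c (r c))
    (hsub : ∀ c ∈ t, Metric.closedBall c (r c) ⊆ D)
    (hcov : volume (D \ ⋃ c ∈ t, Metric.closedBall c (r c)) = 0)
    {w : (ι → ℝ) → (ι → ℝ) → ι → ℝ} {H : (ι → ℝ) → (ι → ℝ) → Matrix ι ι ℝ}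
    (hw : ∀ c ∈ t, Adm α (Metric.ball c (r c)) (w c) (H c)) {e K : ℝ} (he : 0 ≤ e)
    (hwe : ∀ c ∈ t, ∀ x y, dist (w c x) (w c y) ≤ e * dist x y ^ α)
    (hHK : ∀ c ∈ t, ∀ x k l, |H c x k l| ≤ K) :
    ∃ (W : (ι → ℝ) → ι → ℝ) (Z : (ι → ℝ) → Matrix ι ι ℝ), Adm α D W Z ∧
      (∀ x y, dist (W x) (W y) ≤ 2 * e * dist x y ^ α) ∧
      (∀ c ∈ t, ∀ x ∈ Metric.closedBall c (r c), Z x = H c x) ∧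
      ∀ x, (∀ c ∈ t, x ∉ Metric.closedBall c (r c)) → Z x = 0 := by
  classical
  set W : (ι → ℝ) → ι → ℝ := fun x =>
    if hx : ∃ c ∈ t, x ∈ Metric.closedBall c (r c) then w hx.choose x else 0 with hWdef
  set Z : (ι → ℝ) → Matrix ι ι ℝ := fun x =>
    if hx : ∃ c ∈ t, x ∈ Metric.closedBall c (r c) then H hx.choose x else 0 with hZdef
  have huniq : ∀ c ∈ t, ∀ c' ∈ t, ∀ x, x ∈ Metric.closedBall c (r c) →
      x ∈ Metric.closedBall c' (r c') → c = c' := fun c hc c' hc' x hx hx' =>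
    hdisj.elim_set hc hc' x hx hx'
  have hW : ∀ c ∈ t, ∀ x ∈ Metric.closedBall c (r c), W x = w c x := by
    intro c hc x hx
    have hex : ∃ c ∈ t, x ∈ Metric.closedBall c (r c) := ⟨c, hc, hx⟩
    have h1 : hex.choose = c :=
      huniq _ hex.choose_spec.1 _ hc x hex.choose_spec.2 hx
    simp only [hWdef]
    rw [dif_pos hex, h1]
  have hZ : ∀ c ∈ t, ∀ x ∈ Metric.closedBall c (r c), Z x = H c x := by
    intro c hc x hx
    have hex : ∃ c ∈ t, x ∈ Metric.closedBall c (r c) := ⟨c, hc, hx⟩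
    have h1 : hex.choose = c :=
      huniq _ hex.choose_spec.1 _ hc x hex.choose_spec.2 hx
    simp only [hZdef]
    rw [dif_pos hex, h1]
  have hW0 : ∀ x, (∀ c ∈ t, x ∉ Metric.closedBall c (r c)) → W x = 0 := by
    intro x hx
    simp only [hWdef]
    rw [dif_neg (by simpa using hx)]
  have hZ0 : ∀ x, (∀ c ∈ t, x ∉ Metric.closedBall c (r c)) → Z x = 0 := by
    intro x hx
    simp only [hZdef]
    rw [dif_neg (by simpa using hx)]
  have hnorm : ∀ x y, (∀ c ∈ t, x ∈ Metric.closedBall c (r c) → y ∉ Metric.closedBall c (r c)) →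
      dist (W x) 0 ≤ e * dist x y ^ α := by
    intro x y hxy
    by_cases hx : ∃ c ∈ t, x ∈ Metric.closedBall c (r c)
    · obtain ⟨c, hc, hx⟩ := hx
      rw [hW c hc x hx, ← (hw c hc).zero y fun hy => hxy c hc hx (Metric.ball_subset_closedBall hy)]
      exact hwe c hc x y
    · rw [hW0 x (by simpa using hx), dist_self]
      positivity
  have hhol : ∀ x y, dist (W x) (W y) ≤ 2 * e * dist x y ^ α := by
    intro x y
    by_cases hxy : ∃ c ∈ t, x ∈ Metric.closedBall c (r c) ∧ y ∈ Metric.closedBall c (r c)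
    · obtain ⟨c, hc, hx, hy⟩ := hxy
      rw [hW c hc x hx, hW c hc y hy]
      refine (hwe c hc x y).trans ?_
      have : 0 ≤ e * dist x y ^ α := by positivity
      linarith
    · push Not at hxy
      have h1 := hnorm x y hxy
      have h2 := hnorm y x fun c hc hy hx => hxy c hc hx hy
      rw [dist_comm y x] at h2
      have h3 := dist_triangle (W x) 0 (W y)
      rw [dist_comm 0] at h3
      linarith
  have hcont : Continuous W := continuous_of_holder hα hhol
  set S := ⋃ c ∈ t, Metric.closedBall c (r c) with hS
  have hSm : MeasurableSet S := MeasurableSet.biUnion ht fun _ _ => measurableSet_closedBall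
  have hSn : ∀ x, x ∉ S → ∀ c ∈ t, x ∉ Metric.closedBall c (r c) := by
    intro x hx c hc hxc
    exact hx (mem_biUnion hc hxc)
  have hSD : S ⊆ D := iUnion₂_subset hsub
  have hZbdd : ∀ x k l, |Z x k l| ≤ max K 0 := by
    intro x k l
    by_cases hx : ∃ c ∈ t, x ∈ Metric.closedBall c (r c)
    · obtain ⟨c, hc, hx⟩ := hx
      rw [hZ c hc x hx]
      exact (hHK c hc x k l).trans (le_max_left _ _)
    · rw [hZ0 x (by simpa using hx)]
      simp
  have hZmeas : ∀ k l, AEMeasurable (fun x => Z x k l) := by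
    intro k l
    have h1 : (fun x => Z x k l) = indicator S fun x => Z x k l := by
      ext x
      by_cases hx : x ∈ S
      · rw [indicator_of_mem hx]
      · rw [indicator_of_notMem hx, hZ0 x (hSn x hx), Matrix.zero_apply]
    rw [h1, aemeasurable_indicator_iff hSm]
    have := ht.to_subtype
    rw [hS, biUnion_eq_iUnion, aemeasurable_iUnion_iff]
    intro c
    refine ((hw c c.2).meas k l).restrict.congr ?_
    filter_upwards [ae_restrict_mem measurableSet_closedBall] with x hx
    rw [hZ c c.2 x hx]
  have hsph : ∀ᵐ x : ι → ℝ, ∀ c ∈ t, x ∉ Metric.sphere c (r c) := by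
    rw [ae_ball_iff ht]
    exact fun c hc => measure_eq_zero_iff_ae_notMem.mp
      (Measure.addHaar_sphere_of_ne_zero volume c (hr c hc).ne')
  refine ⟨W, Z, ⟨⟨2 * e, by positivity, hhol⟩, fun x hx => hW0 x (hSn x fun h => hx (hSD h)),
    fun x hx => hZ0 x (hSn x fun h => hx (hSD h)), ⟨_, hZbdd⟩, hZmeas, ?_, ?_⟩, hhol, hZ, hZ0⟩
  · have hl : ∀ᵐ x : ι → ℝ, ∀ c ∈ t, x ∈ Metric.ball c (r c) → ∃ ρ > 0, ∀ y ∈ Metric.closedBall x ρ,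
        H c y = H c x ∧ w c y = w c x + (H c x).mulVec (y - x) := by
      rw [ae_ball_iff ht]
      exact fun c hc => (hw c hc).locAffine
    have hc : ∀ᵐ x : ι → ℝ, x ∈ D → x ∈ S := by
      filter_upwards [measure_eq_zero_iff_ae_notMem.mp hcov] with x hx hxD
      by_contra h
      exact hx ⟨hxD, h⟩
    filter_upwards [hl, hc, hsph] with x hl hc hsph hxD
    obtain ⟨c, hct, hxc⟩ := mem_iUnion₂.mp (hc hxD)
    have hxb : x ∈ Metric.ball c (r c) := lt_of_le_of_ne hxc (hsph c hct)
    obtain ⟨ρ, hρ, hρ'⟩ := hl c hct hxb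
    obtain ⟨σ, hσ, hσ'⟩ := Metric.nhds_basis_closedBall.mem_iff.mp (Metric.isOpen_ball.mem_nhds hxb)
    refine ⟨min ρ σ, lt_min hρ hσ, fun y hy => ?_⟩
    have hyc := Metric.ball_subset_closedBall
      (hσ' (Metric.closedBall_subset_closedBall (min_le_right _ _) hy))
    rw [hZ c hct y hyc, hZ c hct x hxc, hW c hct y hyc, hW c hct x hxc]
    exact hρ' y (Metric.closedBall_subset_closedBall (min_le_left _ _) hy)
  · intro φ hφ hc k l
    obtain ⟨h1, h2⟩ := integrable_fderiv_apply hφ hc (Pi.single l 1)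
    have i1 := integrable_mul_of_continuous (continuous_pi_iff.mp hcont k) h1 h2
    have i2 := integrable_mul_of_bdd (hZmeas k l) (fun x => hZbdd x k l) (hφ 0).continuous hc
    have := ht.to_subtype
    have key : ∀ g : (ι → ℝ) → ℝ, Integrable g → (∀ x ∉ S, g x = 0) →
        ∫ x, g x = ∑' c : t, ∫ x in Metric.closedBall (c : ι → ℝ) (r c), g x := by
      intro g hg hg0
      rw [← setIntegral_eq_integral_of_forall_compl_eq_zero hg0, hS, biUnion_eq_iUnion,
        MeasureTheory.integral_iUnion (s := fun c : t => Metric.closedBall (c : ι → ℝ) (r c)) (fun c => measurableSet_closedBall)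
          (fun a b hab => hdisj a.2 b.2 (fun h => hab (Subtype.ext h))) hg.integrableOn]
    rw [key _ i1 (fun x hx => by rw [hW0 x (hSn x hx)]; simp),
      key _ i2 (fun x hx => by rw [hZ0 x (hSn x hx)]; simp), ← tsum_neg]
    refine tsum_congr fun c => ?_
    have loc : ∀ g g' : (ι → ℝ) → ℝ, (∀ x ∈ Metric.closedBall (c : ι → ℝ) (r c), g x = g' x) →
        (∀ x, x ∉ Metric.ball (c : ι → ℝ) (r c) → g' x = 0) →
        ∫ x in Metric.closedBall (c : ι → ℝ) (r c), g x = ∫ x, g' x := by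
      intro g g' hg hg'
      rw [setIntegral_congr_fun measurableSet_closedBall hg]
      exact setIntegral_eq_integral_of_forall_compl_eq_zero
        fun x hx => hg' x fun h => hx (Metric.ball_subset_closedBall h)
    have e1 := loc (fun x => W x k * fderiv ℝ φ x (Pi.single l 1))
      (fun x => w c x k * fderiv ℝ φ x (Pi.single l 1)) (fun x hx => by rw [hW c c.2 x hx])
      (fun x hx => by rw [(hw c c.2).zero x hx]; simp)
    have e2 := loc (fun x => Z x k l * φ x) (fun x => H c x k l * φ x)
      (fun x hx => by rw [hZ c c.2 x hx]) (fun x hx => by rw [(hw c c.2).grad_zero x hx]; simp)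
    rw [e1, e2, (hw c c.2).weak φ hφ hc k l]

end

section

variable [Fintype ι] [DecidableEq ι] [Nonempty ι]

/-- Replacing the locally affine pieces of an admissible perturbation by rescaled copies of
perturbations that depend on the local gradient. -/
lemma Adm.compose {α : ℝ} (hα0 : 0 < α) (hα1 : α < 1) {D : Set (ι → ℝ)} (hD : IsOpen D)
    {v : (ι → ℝ) → ι → ℝ} {G : (ι → ℝ) → Matrix ι ι ℝ} (h : Adm α D v G)
    {V : Matrix ι ι ℝ → (ι → ℝ) → ι → ℝ} {H : Matrix ι ι ℝ → (ι → ℝ) → Matrix ι ι ℝ}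
    (hV : ∀ Y, Adm α (Metric.ball 0 1) (V Y) (H Y)) {K : ℝ} (hK : ∀ Y x k l, |H Y x k l| ≤ K)
    {ε : ℝ} (hε : 0 < ε) :
    ∃ (v' : (ι → ℝ) → ι → ℝ) (G' : (ι → ℝ) → Matrix ι ι ℝ), Adm α D v' G' ∧
      (∀ x y, dist (v' x - v x) (v' y - v y) ≤ ε * dist x y ^ α) ∧
      (∀ x, ∃ z, G' x = G x + H (G x) z) ∧
      ∀ f : Matrix ι ι ℝ → ENNReal, ∫⁻ x in D, f (G' x) =
        ∫⁻ x in D, (volume (Metric.ball (0 : ι → ℝ) 1))⁻¹ *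
          ∫⁻ z in Metric.ball 0 1, f (G x + H (G x) z) := by
  choose C hC0 hC using fun Y => (hV Y).holder
  set s : Set (ι → ℝ) := {x | x ∈ D ∧ ∃ ρ > 0, ∀ y ∈ Metric.closedBall x ρ,
    G y = G x ∧ v y = v x + (G x).mulVec (y - x)} with hs
  have hDs : volume (D \ s) = 0 := by
    refine measure_mono_null ?_ (ae_iff.mp h.locAffine)
    rintro x ⟨hxD, hxs⟩ hx
    exact hxs ⟨hxD, hx hxD⟩
  set F : (ι → ℝ) → Set ℝ := fun x => {r | Metric.closedBall x r ⊆ D ∧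
    (∀ y ∈ Metric.closedBall x r, G y = G x) ∧ r ^ (1 - α) * C (G x) ≤ ε / 2} with hF
  have hFne : ∀ x ∈ s, ∀ δ > 0, (F x ∩ Ioo 0 δ).Nonempty := by
    rintro x ⟨hxD, ρ, hρ, hρ'⟩ δ hδ
    obtain ⟨σ, hσ, hσ'⟩ := Metric.nhds_basis_closedBall.mem_iff.mp (hD.mem_nhds hxD)
    have hc : ContinuousAt (fun r : ℝ => r ^ (1 - α) * C (G x)) 0 :=
      (Real.continuousAt_rpow_const 0 _ (Or.inr (by linarith))).mul_const _
    have h1 : ∀ᶠ r : ℝ in 𝓝 0, r ^ (1 - α) * C (G x) < ε / 2 := by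
      refine hc.eventually_lt continuousAt_const ?_
      rw [Real.zero_rpow (by linarith), zero_mul]
      linarith
    have h2 : ∀ᶠ r : ℝ in 𝓝[>] 0, r ^ (1 - α) * C (G x) < ε / 2 ∧ r < ρ ∧ r < σ ∧ r < δ ∧ 0 < r :=
      ((h1.filter_mono nhdsWithin_le_nhds).and <|
        ((eventually_lt_nhds hρ).filter_mono nhdsWithin_le_nhds).and <|
        ((eventually_lt_nhds hσ).filter_mono nhdsWithin_le_nhds).and <|
        ((eventually_lt_nhds hδ).filter_mono nhdsWithin_le_nhds).and self_mem_nhdsWithin)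
    obtain ⟨r, hr1, hr2, hr3, hr4, hr5⟩ := h2.exists
    exact ⟨r, ⟨(Metric.closedBall_subset_closedBall hr3.le).trans hσ', fun y hy =>
      (hρ' y (Metric.closedBall_subset_closedBall hr2.le hy)).1, hr1.le⟩, hr5, hr4⟩
  obtain ⟨t, r, ht, hts, htr, hcov, hdisj⟩ := Besicovitch.exists_disjoint_closedBall_covering_ae
    (volume : Measure (ι → ℝ)) F s hFne (fun _ => 1) (fun _ _ => one_pos)
  have hr : ∀ c ∈ t, 0 < r c := fun c hc => (htr c hc).2.1
  have hsub : ∀ c ∈ t, Metric.closedBall c (r c) ⊆ D := fun c hc => (htr c hc).1.1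
  have hcst : ∀ c ∈ t, ∀ y ∈ Metric.closedBall c (r c), G y = G c := fun c hc => (htr c hc).1.2.1
  have hcov' : volume (D \ ⋃ c ∈ t, Metric.closedBall c (r c)) = 0 := by
    refine measure_mono_null ?_ (measure_union_null hDs hcov)
    rintro x ⟨hxD, hx⟩
    by_cases hxs : x ∈ s
    · exact Or.inr ⟨hxs, hx⟩
    · exact Or.inl ⟨hxD, hxs⟩
  obtain ⟨W, Z, hWZ, hWh, hZ, hZ0⟩ := Adm.glue hα0 ht hr hdisj hsub hcov'
    (w := fun c x => r c • V (G c) ((r c)⁻¹ • (x - c)))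
    (H := fun c x => H (G c) ((r c)⁻¹ • (x - c)))
    (fun c hc => (hV (G c)).rescale c (hr c hc)) (e := ε / 2) (K := K) (by linarith)
    (fun c hc x y => (rescale_holder (hC (G c)) c (hr c hc) x y).trans (by
      gcongr; exact (htr c hc).1.2.2))
    (fun c hc x => hK _ _)
  refine ⟨fun x => v x + W x, fun x => G x + Z x, h.add hα0 hWZ, fun x y => ?_, fun x => ?_,
    fun f => ?_⟩
  · simpa using (hWh x y).trans_eq (by ring)
  · by_cases hx : ∃ c ∈ t, x ∈ Metric.closedBall c (r c)
    · obtain ⟨c, hc, hx⟩ := hx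
      refine ⟨(r c)⁻¹ • (x - c), ?_⟩
      simp only [hZ c hc x hx, hcst c hc x hx]
    · refine ⟨fun _ => 1, ?_⟩
      simp only
      rw [hZ0 x (by simpa using hx), (hV (G x)).grad_zero _ (by simp [pi_norm_const])]
  · set S := ⋃ c ∈ t, Metric.closedBall c (r c) with hS
    have hDS : (D : Set (ι → ℝ)) =ᵐ[volume] S :=
      Filter.EventuallyLE.antisymm (ae_le_set.mpr hcov') (LE.le.eventuallyLE (iUnion₂_subset hsub))
    rw [setLIntegral_congr hDS, setLIntegral_congr hDS, hS,
      lintegral_biUnion ht (fun c _ => measurableSet_closedBall) hdisj,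
      lintegral_biUnion ht (fun c _ => measurableSet_closedBall) hdisj]
    refine tsum_congr fun c => ?_
    have hcb : ∀ g : (ι → ℝ) → ENNReal, ∫⁻ x in Metric.closedBall (c : ι → ℝ) (r c), g x
        = ∫⁻ x in Metric.ball (c : ι → ℝ) (r c), g x := by
      intro g
      refine setLIntegral_congr (EventuallyLE.antisymm (ae_le_set.mpr ?_)
        (LE.le.eventuallyLE Metric.ball_subset_closedBall))
      rw [Metric.closedBall_sdiff_ball]
      exact Measure.addHaar_sphere_of_ne_zero volume _ (hr c c.2).ne'
    set B := Metric.ball (0 : ι → ℝ) 1 with hB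
    have hB0 : volume B ≠ 0 := (Metric.measure_ball_pos volume _ one_pos).ne'
    have hBt : volume B ≠ ⊤ := measure_ball_lt_top.ne
    calc ∫⁻ x in Metric.closedBall (c : ι → ℝ) (r c), f (G x + Z x)
        = ∫⁻ x in Metric.closedBall (c : ι → ℝ) (r c),
            (fun z => f (G c + H (G c) z)) ((r c)⁻¹ • (x - c)) :=
          setLIntegral_congr_fun measurableSet_closedBall fun x hx => by
            simp only [hcst c c.2 x hx, hZ c c.2 x hx]
      _ = ENNReal.ofReal (r c ^ Module.finrank ℝ (ι → ℝ)) *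
            ∫⁻ z in B, f (G c + H (G c) z) :=
          (hcb _).trans (setLIntegral_rescale (c : ι → ℝ) (hr c c.2) fun z => f (G c + H (G c) z))
      _ = ((volume B)⁻¹ * ∫⁻ z in B, f (G c + H (G c) z)) *
            volume (Metric.closedBall (c : ι → ℝ) (r c)) := by
          rw [Measure.addHaar_closedBall volume _ (hr c c.2).le, ← hB]
          rw [mul_comm (ENNReal.ofReal _) (volume B), ← mul_assoc, mul_right_comm _ _ (volume B),
            ENNReal.inv_mul_cancel hB0 hBt, one_mul, mul_comm]
      _ = ∫⁻ x in Metric.closedBall (c : ι → ℝ) (r c), (volume B)⁻¹ *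
            ∫⁻ z in B, f (G c + H (G c) z) := by
          rw [setLIntegral_const]
      _ = ∫⁻ x in Metric.closedBall (c : ι → ℝ) (r c), (volume B)⁻¹ *
            ∫⁻ z in B, f (G x + H (G x) z) :=
          setLIntegral_congr_fun measurableSet_closedBall fun x hx => by
            simp only [hcst c c.2 x hx]

end

section

variable [Fintype ι] [DecidableEq ι]

/-- Starting from the affine map of gradient `X`, an admissible perturbation on the unit cube with
gradient bounded by `2 * R` makes the average of `f` along the gradient at most `c`. -/
def Att (α R : ℝ) (f : Matrix ι ι ℝ → ENNReal) (X : Matrix ι ι ℝ) (c : ℝ) : Prop :=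
  ∃ (v : (ι → ℝ) → ι → ℝ) (G : (ι → ℝ) → Matrix ι ι ℝ), Adm α (Metric.ball 0 1) v G ∧
    (∀ x k l, |X k l + G x k l| ≤ 2 * R) ∧
    ∫⁻ x in Metric.ball 0 1, f (X + G x) ≤ ENNReal.ofReal c * volume (Metric.ball (0 : ι → ℝ) 1)

/-- The laminate envelope of `f` at `X` is at most `c`. -/
def Reach (α R : ℝ) (f : Matrix ι ι ℝ → ENNReal) (X : Matrix ι ι ℝ) (c : ℝ) : Prop :=
  0 ≤ c ∧ ∀ c' > c, Att α R f X c'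

variable {α R K : ℝ} {f : Matrix ι ι ℝ → ENNReal}

lemma Reach.mono {X : Matrix ι ι ℝ} {c c' : ℝ} (h : Reach α R f X c) (hc : c ≤ c') :
    Reach α R f X c' :=
  ⟨h.1.trans hc, fun d hd => h.2 d (hc.trans_lt hd)⟩

lemma Reach.of_le {X : Matrix ι ι ℝ} {c : ℝ} (hX : ∀ k l, |X k l| ≤ 2 * R) (hc : 0 ≤ c)
    (hf : f X ≤ ENNReal.ofReal c) : Reach α R f X c := by
  refine ⟨hc, fun c' hc' => ⟨0, 0, Adm.zero_zero _, fun x k l => by simpa using hX k l, ?_⟩⟩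
  simp only [Pi.zero_apply, add_zero, setLIntegral_const]
  gcongr
  exact hf.trans (ENNReal.ofReal_le_ofReal hc'.le)

variable [Nonempty ι]

lemma Reach.midpoint_of_pos (hα0 : 0 < α) (hα1 : α < 1) (hR : 0 < R) (hK : 0 ≤ K)
    (hf : ∀ Y : Matrix ι ι ℝ, (∀ k l, |Y k l| ≤ 2 * R) → f Y ≤ ENNReal.ofReal K)
    {X : Matrix ι ι ℝ} (hX : ∀ k l, |X k l| ≤ R) {i j : ι} {a c₁ c₂ : ℝ} (ha : 0 < a)
    (h₁ : Reach α R f (X + Matrix.single i j a) c₁)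
    (h₂ : Reach α R f (X + Matrix.single i j (-a)) c₂) :
    Reach α R f X ((c₁ + c₂) / 2) := by
  classical
  obtain ⟨hc₁, h₁⟩ := h₁
  obtain ⟨hc₂, h₂⟩ := h₂
  refine ⟨by positivity, fun c' hc' => ?_⟩
  set d := c' - (c₁ + c₂) / 2 with hd
  have hd0 : 0 < d := by linarith
  obtain ⟨v₁, G₁, hv₁, hb₁, hi₁⟩ := h₁ (c₁ + d / 2) (by linarith)
  obtain ⟨v₂, G₂, hv₂, hb₂, hi₂⟩ := h₂ (c₂ + d / 2) (by linarith)
  set K' := K + (c₁ + d / 2) + (c₂ + d / 2) with hK'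
  have hK'0 : 0 < K' := by linarith
  obtain ⟨v, G, P, N, hv, hPm, hNm, hPB, hNB, hP, hN, hPN, hGP, hGN, hG⟩ :=
    exists_split hα0 hα1 i j ha hR (show 0 < d / 2 / K' by positivity)
  have hne : Matrix.single i j a ≠ Matrix.single i j (-a) := by
    intro h
    have := congrFun (congrFun h i) j
    simp only [Matrix.single_apply_same] at this
    linarith
  set V : Matrix ι ι ℝ → (ι → ℝ) → ι → ℝ := fun Y =>
    if Y = Matrix.single i j a then v₁ else if Y = Matrix.single i j (-a) then v₂ else 0 with hV
  set H : Matrix ι ι ℝ → (ι → ℝ) → Matrix ι ι ℝ := fun Y =>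
    if Y = Matrix.single i j a then G₁ else if Y = Matrix.single i j (-a) then G₂ else 0 with hH
  have H1 : H (Matrix.single i j a) = G₁ := by simp [hH]
  have H2 : H (Matrix.single i j (-a)) = G₂ := by
    simp only [hH]; rw [if_neg hne.symm]; simp
  have H3 : ∀ Y, Y ≠ Matrix.single i j a → Y ≠ Matrix.single i j (-a) → H Y = 0 := by
    intro Y h h'; simp only [hH]; rw [if_neg h, if_neg h']
  obtain ⟨K₁, hK₁⟩ := hv₁.bdd
  obtain ⟨K₂, hK₂⟩ := hv₂.bdd
  obtain ⟨v', G', hv', -, hG', hint⟩ := hv.compose hα0 hα1 Metric.isOpen_ball (V := V) (H := H)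
    (fun Y => by simp only [hV, hH]; split_ifs <;> [exact hv₁; exact hv₂; exact Adm.zero_zero _])
    (K := max (max K₁ K₂) 0)
    (fun Y x k l => by
      simp only [hH]
      split_ifs
      · exact (hK₁ x k l).trans ((le_max_left _ _).trans (le_max_left _ _))
      · exact (hK₂ x k l).trans ((le_max_right _ _).trans (le_max_left _ _))
      · simp) one_pos
  have hthree : ∀ x, G x = Matrix.single i j a ∨ G x = Matrix.single i j (-a) ∨
      (H (G x) = 0 ∧ ∀ k l, |G x k l| ≤ R) := by
    intro x
    by_cases h1 : G x = Matrix.single i j a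
    · exact Or.inl h1
    by_cases h2 : G x = Matrix.single i j (-a)
    · exact Or.inr (Or.inl h2)
    · exact Or.inr (Or.inr ⟨H3 _ h1 h2, ((hG x).resolve_left h1).resolve_left h2⟩)
  have hsm : ∀ x, (∀ k l, |G x k l| ≤ R) → ∀ k l, |X k l + G x k l| ≤ 2 * R := fun x hx k l =>
    (abs_add_le _ _).trans (by linarith [hX k l, hx k l])
  refine ⟨v', G', hv', fun x k l => ?_, ?_⟩
  · obtain ⟨z, hz⟩ := hG' x
    rw [hz, Matrix.add_apply, ← add_assoc]
    rcases hthree x with h | h | ⟨h, h'⟩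
    · rw [h, H1]; exact hb₁ z k l
    · rw [h, H2]; exact hb₂ z k l
    · rw [h]; simpa using hsm x h' k l
  · set B := Metric.ball (0 : ι → ℝ) 1 with hB
    have hB0 : volume B ≠ 0 := (Metric.measure_ball_pos volume _ one_pos).ne'
    have hBt : volume B ≠ ⊤ := measure_ball_lt_top.ne
    set Φ : Matrix ι ι ℝ → ENNReal := fun Y =>
      (volume B)⁻¹ * ∫⁻ z in B, f (X + (Y + H Y z)) with hΦ
    have avg : ∀ (g : (ι → ℝ) → ENNReal) (c : ENNReal), ∫⁻ z in B, g z ≤ c * volume B →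
        (volume B)⁻¹ * ∫⁻ z in B, g z ≤ c := by
      intro g c hg
      calc (volume B)⁻¹ * ∫⁻ z in B, g z ≤ (volume B)⁻¹ * (c * volume B) := by gcongr
        _ = c := by rw [mul_comm c, ← mul_assoc, ENNReal.inv_mul_cancel hB0 hBt, one_mul]
    have Φ1 : Φ (Matrix.single i j a) ≤ ENNReal.ofReal (c₁ + d / 2) := by
      simp only [hΦ, H1, ← add_assoc]; exact avg _ _ hi₁
    have Φ2 : Φ (Matrix.single i j (-a)) ≤ ENNReal.ofReal (c₂ + d / 2) := by
      simp only [hΦ, H2, ← add_assoc]; exact avg _ _ hi₂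
    have Φ3 : ∀ x, Φ (G x) ≤ ENNReal.ofReal K' := by
      intro x
      rcases hthree x with h | h | ⟨h, h'⟩
      · rw [h]; exact Φ1.trans (ENNReal.ofReal_le_ofReal (by linarith))
      · rw [h]; exact Φ2.trans (ENNReal.ofReal_le_ofReal (by linarith))
      · simp only [hΦ, h]
        refine avg _ _ ?_
        simp only [Pi.zero_apply, add_zero, setLIntegral_const]
        gcongr
        exact (hf _ (hsm x h')).trans (ENNReal.ofReal_le_ofReal (by linarith))
    have half : ∀ (c : ℝ) (Q : Set (ι → ℝ)), 0 ≤ c → 2 * volume Q ≤ volume B →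
        ENNReal.ofReal c * volume Q ≤ ENNReal.ofReal (c / 2) * volume B := by
      intro c Q hc hQ
      calc ENNReal.ofReal c * volume Q = ENNReal.ofReal (c / 2) * (2 * volume Q) := by
            rw [← mul_assoc, show c = c / 2 * 2 by ring, ENNReal.ofReal_mul (by positivity)]
            simp
        _ ≤ _ := by gcongr
    have cst : ∀ (c : ENNReal) (Q : Set (ι → ℝ)), MeasurableSet Q → (∀ x ∈ Q, Φ (G x) ≤ c) →
        ∫⁻ x in Q, Φ (G x) ≤ c * volume Q := by
      intro c Q hQ hc
      rw [← setLIntegral_const]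
      exact setLIntegral_mono' hQ hc
    have hBPN : B ⊆ (P ∪ N) ∪ (B \ (P ∪ N)) := by
      rw [union_sdiff_self]; exact subset_union_right
    calc ∫⁻ x in B, f (X + G' x) = ∫⁻ x in B, Φ (G x) := hint fun Y => f (X + Y)
      _ ≤ ∫⁻ x in (P ∪ N) ∪ (B \ (P ∪ N)), Φ (G x) := lintegral_mono_set hBPN
      _ ≤ (∫⁻ x in P, Φ (G x)) + (∫⁻ x in N, Φ (G x)) + ∫⁻ x in B \ (P ∪ N), Φ (G x) :=
        (lintegral_union_le _ _ _).trans (add_le_add (lintegral_union_le _ _ _) le_rfl)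
      _ ≤ ENNReal.ofReal (c₁ + d / 2) * volume P + ENNReal.ofReal (c₂ + d / 2) * volume N
          + ENNReal.ofReal K' * volume (B \ (P ∪ N)) := by
        refine add_le_add (add_le_add (cst _ _ hPm fun x hx => ?_) (cst _ _ hNm fun x hx => ?_))
          (cst _ _ (measurableSet_ball.diff (hPm.union hNm)) fun x _ => Φ3 x)
        · rw [hGP x hx]; exact Φ1
        · rw [hGN x hx]; exact Φ2
      _ ≤ ENNReal.ofReal ((c₁ + d / 2) / 2) * volume B + ENNReal.ofReal ((c₂ + d / 2) / 2) * volume B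
          + ENNReal.ofReal K' * (ENNReal.ofReal (d / 2 / K') * volume B) :=
        add_le_add (add_le_add (half _ _ (by linarith) hP) (half _ _ (by linarith) hN))
          (by gcongr)
      _ = ENNReal.ofReal c' * volume B := by
        rw [← mul_assoc, ← ENNReal.ofReal_mul hK'0.le, ← add_mul, ← add_mul,
          ← ENNReal.ofReal_add (by linarith) (by linarith),
          ← ENNReal.ofReal_add (by linarith) (by positivity)]
        congr 2
        field_simp
        rw [hd]
        ring

lemma Reach.midpoint (hα0 : 0 < α) (hα1 : α < 1) (hR : 0 < R) (hK : 0 ≤ K)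
    (hf : ∀ Y : Matrix ι ι ℝ, (∀ k l, |Y k l| ≤ 2 * R) → f Y ≤ ENNReal.ofReal K)
    {X : Matrix ι ι ℝ} (hX : ∀ k l, |X k l| ≤ R) {i j : ι} {a c₁ c₂ : ℝ}
    (h₁ : Reach α R f (X + Matrix.single i j a) c₁)
    (h₂ : Reach α R f (X + Matrix.single i j (-a)) c₂) :
    Reach α R f X ((c₁ + c₂) / 2) := by
  rcases lt_trichotomy a 0 with ha | rfl | ha
  · rw [add_comm c₁]
    exact Reach.midpoint_of_pos hα0 hα1 hR hK hf hX (neg_pos.mpr ha) h₂ (by rwa [neg_neg])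
  · simp only [neg_zero, Matrix.single_zero, add_zero] at h₁ h₂
    rcases le_total c₁ c₂ with h | h
    · exact h₁.mono (by linarith)
    · exact h₂.mono (by linarith)
  · exact Reach.midpoint_of_pos hα0 hα1 hR hK hf hX ha h₁ h₂

lemma Reach.interpolate (hα0 : 0 < α) (hα1 : α < 1) (hR : 0 < R) (hK : 0 ≤ K)
    (hf : ∀ Y : Matrix ι ι ℝ, (∀ k l, |Y k l| ≤ 2 * R) → f Y ≤ ENNReal.ofReal K)
    {P : Matrix ι ι ℝ} {i j : ι} {d A B θ : ℝ} (hP : ∀ k l, |P k l| ≤ R)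
    (hQ : ∀ k l, |(P + Matrix.single i j d) k l| ≤ R)
    (hA : Reach α R f P A) (hB : Reach α R f (P + Matrix.single i j d) B) (hθ : θ ∈ Icc (0 : ℝ) 1) :
    Reach α R f (P + Matrix.single i j (θ * d)) ((1 - θ) * A + θ * B) := by
  have hA0 := hA.1
  have hB0 := hB.1
  have hin : ∀ θ ∈ Icc (0 : ℝ) 1, ∀ k l, |(P + Matrix.single i j (θ * d)) k l| ≤ R := by
    rintro θ ⟨h0, h1⟩ k l
    have e : (P + Matrix.single i j (θ * d)) k l
        = (1 - θ) * P k l + θ * (P + Matrix.single i j d) k l := by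
      simp only [Matrix.add_apply, Matrix.single_apply]
      split_ifs <;> ring
    rw [e]
    calc _ ≤ |(1 - θ) * P k l| + |θ * (P + Matrix.single i j d) k l| := abs_add_le _ _
      _ = (1 - θ) * |P k l| + θ * |(P + Matrix.single i j d) k l| := by
        rw [abs_mul, abs_mul, abs_of_nonneg h0, abs_of_nonneg (sub_nonneg.mpr h1)]
      _ ≤ (1 - θ) * R + θ * R :=
        add_le_add (mul_le_mul_of_nonneg_left (hP k l) (sub_nonneg.mpr h1))
          (mul_le_mul_of_nonneg_left (hQ k l) h0)
      _ = R := by ring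
  have key : ∀ m : ℕ, ∀ θ ∈ Icc (0 : ℝ) 1,
      Reach α R f (P + Matrix.single i j (θ * d)) ((1 - θ) * A + θ * B + K * (2⁻¹ : ℝ) ^ m) := by
    intro m
    induction m with
    | zero =>
      rintro θ ⟨h0, h1⟩
      have hnn : 0 ≤ (1 - θ) * A + θ * B :=
        add_nonneg (mul_nonneg (by linarith) hA0) (mul_nonneg h0 hB0)
      have hin2 : ∀ k l, |(P + Matrix.single i j (θ * d)) k l| ≤ 2 * R := fun k l =>
        (hin θ ⟨h0, h1⟩ k l).trans (by linarith)
      exact (Reach.of_le hin2 hK (hf _ hin2)).mono (by simpa using hnn)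
    | succ m ih =>
      rintro θ ⟨h0, h1⟩
      rcases le_total θ (1 / 2) with h | h
      · have e1 : P + Matrix.single i j (θ * d) + Matrix.single i j (θ * d)
            = P + Matrix.single i j (2 * θ * d) := by
          rw [add_assoc, ← Matrix.single_add]; congr 2; ring
        have e2 : P + Matrix.single i j (θ * d) + Matrix.single i j (-(θ * d)) = P := by
          rw [add_assoc, ← Matrix.single_add]; simp
        have := Reach.midpoint hα0 hα1 hR hK hf (hin θ ⟨h0, h1⟩) (i := i) (j := j) (a := θ * d)
          (by rw [e1]; exact ih (2 * θ) ⟨by linarith, by linarith⟩) (by rw [e2]; exact hA)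
        exact this.mono (le_of_eq (by rw [pow_succ]; ring))
      · have e1 : P + Matrix.single i j (θ * d) + Matrix.single i j ((1 - θ) * d)
            = P + Matrix.single i j d := by
          rw [add_assoc, ← Matrix.single_add]; congr 2; ring
        have e2 : P + Matrix.single i j (θ * d) + Matrix.single i j (-((1 - θ) * d))
            = P + Matrix.single i j ((2 * θ - 1) * d) := by
          rw [add_assoc, ← Matrix.single_add]; congr 2; ring
        have := Reach.midpoint hα0 hα1 hR hK hf (hin θ ⟨h0, h1⟩) (i := i) (j := j) (a := (1 - θ) * d)
          (by rw [e1]; exact hB)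
          (by rw [e2]; exact ih (2 * θ - 1) ⟨by linarith, by linarith⟩)
        exact this.mono (le_of_eq (by rw [pow_succ]; ring))
  refine ⟨add_nonneg (mul_nonneg (sub_nonneg.mpr hθ.2) hA0) (mul_nonneg hθ.1 hB0),
    fun c' hc' => ?_⟩
  have hlim : Tendsto (fun m : ℕ => (1 - θ) * A + θ * B + K * (2⁻¹ : ℝ) ^ m) atTop
      (𝓝 ((1 - θ) * A + θ * B + K * 0)) :=
    ((tendsto_pow_atTop_nhds_zero_of_lt_one (by norm_num) (by norm_num)).const_mul K).const_add _
  rw [mul_zero, add_zero] at hlim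
  obtain ⟨m, hm⟩ := (hlim.eventually_lt_const hc').exists
  exact (key m θ hθ).2 c' hm

end

section

variable [Fintype ι]

/-- The sum of the products of the absolute values of pairs of different entries. -/
def pairSum (X : Matrix ι ι ℝ) : ℝ :=
  (∑ p : ι × ι, |X p.1 p.2|) ^ 2 - ∑ p : ι × ι, X p.1 p.2 ^ 2

open Classical in
/-- The cost function measuring the distance of a matrix from `S` at scale `R`. -/
def cost (S : Set (Matrix ι ι ℝ)) (R : ℝ) (X : Matrix ι ι ℝ) : ENNReal :=
  if X ∈ S then 0 else ENNReal.ofReal (max (pairSum X) (R ^ 2))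

lemma cost_of_mem {S : Set (Matrix ι ι ℝ)} {R : ℝ} {X : Matrix ι ι ℝ} (h : X ∈ S) :
    cost S R X = 0 := if_pos h

lemma cost_of_notMem {S : Set (Matrix ι ι ℝ)} {R : ℝ} {X : Matrix ι ι ℝ} (h : X ∉ S) :
    cost S R X = ENNReal.ofReal (max (pairSum X) (R ^ 2)) := if_neg h

lemma cost_le (S : Set (Matrix ι ι ℝ)) (R : ℝ) (X : Matrix ι ι ℝ) :
    cost S R X ≤ ENNReal.ofReal (max (pairSum X) (R ^ 2)) := by
  unfold cost
  split_ifs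
  · exact zero_le
  · exact le_rfl

lemma pairSum_eq (X : Matrix ι ι ℝ) :
    pairSum X = ∑ p : ι × ι, |X p.1 p.2| * ((∑ q : ι × ι, |X q.1 q.2|) - |X p.1 p.2|) := by
  simp only [mul_sub, Finset.sum_sub_distrib, ← Finset.sum_mul, pairSum, abs_mul_abs_self, sq]

lemma pairSum_term_nonneg (X : Matrix ι ι ℝ) (p : ι × ι) :
    0 ≤ |X p.1 p.2| * ((∑ q : ι × ι, |X q.1 q.2|) - |X p.1 p.2|) :=
  mul_nonneg (abs_nonneg _) (sub_nonneg.mpr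
    (Finset.single_le_sum (f := fun q : ι × ι => |X q.1 q.2|) (fun _ _ => abs_nonneg _)
      (Finset.mem_univ p)))

lemma pairSum_nonneg (X : Matrix ι ι ℝ) : 0 ≤ pairSum X := by
  rw [pairSum_eq]
  exact Finset.sum_nonneg fun p _ => pairSum_term_nonneg X p

lemma mul_le_pairSum (X : Matrix ι ι ℝ) {p q : ι × ι} (h : p ≠ q) :
    |X p.1 p.2| * |X q.1 q.2| ≤ pairSum X := by
  classical
  have h1 : |X q.1 q.2| ≤ (∑ r : ι × ι, |X r.1 r.2|) - |X p.1 p.2| := by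
    rw [← Finset.add_sum_erase _ _ (Finset.mem_univ p), add_sub_cancel_left]
    exact Finset.single_le_sum (f := fun r : ι × ι => |X r.1 r.2|) (fun _ _ => abs_nonneg _)
      (Finset.mem_erase.mpr ⟨h.symm, Finset.mem_univ q⟩)
  rw [pairSum_eq]
  exact (mul_le_mul_of_nonneg_left h1 (abs_nonneg _)).trans
    (Finset.single_le_sum (f := fun p : ι × ι =>
      |X p.1 p.2| * ((∑ q : ι × ι, |X q.1 q.2|) - |X p.1 p.2|))
      (fun p _ => pairSum_term_nonneg X p) (Finset.mem_univ p))

lemma pairSum_le {X : Matrix ι ι ℝ} {R : ℝ} (h : ∀ k l, |X k l| ≤ R) :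
    pairSum X ≤ (Fintype.card ι : ℝ) ^ 4 * R ^ 2 := by
  have h1 : ∑ p : ι × ι, |X p.1 p.2| ≤ (Fintype.card ι : ℝ) ^ 2 * R := by
    calc ∑ p : ι × ι, |X p.1 p.2| ≤ ∑ _p : ι × ι, R := Finset.sum_le_sum fun p _ => h p.1 p.2
      _ = _ := by
        rw [Finset.sum_const, Finset.card_univ, Fintype.card_prod, nsmul_eq_mul]
        push_cast
        ring
  have h2 : 0 ≤ ∑ p : ι × ι, |X p.1 p.2| := Finset.sum_nonneg fun _ _ => abs_nonneg _
  have h3 : 0 ≤ ∑ p : ι × ι, X p.1 p.2 ^ 2 := Finset.sum_nonneg fun _ _ => sq_nonneg _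
  unfold pairSum
  nlinarith [pow_le_pow_left₀ h2 h1 2]

lemma cost_le_of_bdd [Nonempty ι] (S : Set (Matrix ι ι ℝ)) {X : Matrix ι ι ℝ} {R T : ℝ}
    (hR : 0 ≤ R) (hRT : R ≤ T) (h : ∀ k l, |X k l| ≤ T) :
    cost S R X ≤ ENNReal.ofReal ((Fintype.card ι : ℝ) ^ 4 * T ^ 2) := by
  refine (cost_le S R X).trans (ENNReal.ofReal_le_ofReal (max_le (pairSum_le h) ?_))
  have h1 : (1 : ℝ) ≤ (Fintype.card ι : ℝ) ^ 4 :=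
    one_le_pow₀ (by exact_mod_cast Fintype.card_pos)
  calc R ^ 2 ≤ T ^ 2 := by gcongr
    _ ≤ _ := le_mul_of_one_le_left (sq_nonneg _) h1

variable [DecidableEq ι]

lemma pairSum_add_single {X : Matrix ι ι ℝ} {i j : ι} (h : X i j = 0) (t : ℝ) :
    pairSum (X + Matrix.single i j t)
      = pairSum X + 2 * (∑ p : ι × ι, |X p.1 p.2|) * |t| := by
  have e1 : ∀ p : ι × ι, |(X + Matrix.single i j t) p.1 p.2|
      = |X p.1 p.2| + if (i, j) = p then |t| else 0 := by
    rintro ⟨k, l⟩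
    by_cases hp : i = k ∧ j = l
    · obtain ⟨rfl, rfl⟩ := hp
      simp [h]
    · simp [hp]
  have e2 : ∀ p : ι × ι, (X + Matrix.single i j t) p.1 p.2 ^ 2
      = X p.1 p.2 ^ 2 + if (i, j) = p then t ^ 2 else 0 := by
    rintro ⟨k, l⟩
    by_cases hp : i = k ∧ j = l
    · obtain ⟨rfl, rfl⟩ := hp
      simp [h]
    · simp [hp]
  unfold pairSum
  simp only [e1, e2, Finset.sum_add_distrib, Finset.sum_ite_eq, Finset.mem_univ, if_true]
  nlinarith [sq_abs t]

end

section

variable [Fintype ι] [DecidableEq ι] [Nonempty ι] {α R C : ℝ} {S : Set (Matrix ι ι ℝ)}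

lemma reach_zero (hα0 : 0 < α) (hα1 : α < 1) (hR : 0 < R)
    (hs : ∀ (i j : ι) (γ : ℝ), |γ| = R → Reach α R (cost S R) (Matrix.single i j γ) C) :
    Reach α R (cost S R) 0 C := by
  obtain ⟨i⟩ := ‹Nonempty ι›
  have : Nonempty ι := ⟨i⟩
  have := Reach.midpoint hα0 hα1 hR (K := (Fintype.card ι : ℝ) ^ 4 * (2 * R) ^ 2) (by positivity)
    (fun Y hY => cost_le_of_bdd S hR.le (by linarith) hY) (X := (0 : Matrix ι ι ℝ))
    (fun k l => by simpa using hR.le) (i := i) (j := i) (a := R) (c₁ := C) (c₂ := C)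
    (by rw [zero_add]; exact hs i i R (abs_of_pos hR))
    (by rw [zero_add]; exact hs i i (-R) (by rw [abs_neg, abs_of_pos hR]))
  simpa using this

lemma reach_grid (hα0 : 0 < α) (hα1 : α < 1) (hR : 0 < R)
    (hs : ∀ (i j : ι) (γ : ℝ), |γ| = R → Reach α R (cost S R) (Matrix.single i j γ) C)
    {X : Matrix ι ι ℝ} (hX : ∀ k l, X k l = 0 ∨ |X k l| = R) :
    Reach α R (cost S R) X (pairSum X + C) := by
  have h0 := reach_zero hα0 hα1 hR hs
  have hle : ∀ k l, |X k l| ≤ 2 * R := fun k l => by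
    rcases hX k l with h | h
    · rw [h, abs_zero]; linarith
    · linarith
  by_cases h2 : ∃ p q : ι × ι, p ≠ q ∧ X p.1 p.2 ≠ 0 ∧ X q.1 q.2 ≠ 0
  · obtain ⟨p, q, hpq, hp, hq⟩ := h2
    have h := mul_le_pairSum X hpq
    rw [(hX _ _).resolve_left hp, (hX _ _).resolve_left hq, ← sq] at h
    refine (Reach.of_le hle (pairSum_nonneg X) ?_).mono (by linarith [h0.1])
    rw [← max_eq_left h]
    exact cost_le S R X
  · push Not at h2
    by_cases h1 : ∃ p : ι × ι, X p.1 p.2 ≠ 0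
    · obtain ⟨⟨i, j⟩, hp⟩ := h1
      have hXs : X = Matrix.single i j (X i j) := by
        ext k l
        rw [Matrix.single_apply]
        split_ifs with h
        · rw [h.1, h.2]
        · exact h2 (i, j) (k, l) (fun h' => h (by simpa using h')) hp
      have := hs i j (X i j) ((hX _ _).resolve_left hp)
      rw [← hXs] at this
      exact this.mono (by linarith [pairSum_nonneg X])
    · push Not at h1
      have : X = 0 := by ext k l; exact h1 (k, l)
      subst this
      exact h0.mono (by linarith [pairSum_nonneg (0 : Matrix ι ι ℝ)])

lemma reach_cube (hα0 : 0 < α) (hα1 : α < 1) (hR : 0 < R)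
    (hs : ∀ (i j : ι) (γ : ℝ), |γ| = R → Reach α R (cost S R) (Matrix.single i j γ) C)
    {X : Matrix ι ι ℝ} (hX : ∀ k l, |X k l| ≤ R) :
    Reach α R (cost S R) X (pairSum X + C) := by
  suffices H : ∀ T : Finset (ι × ι), ∀ X : Matrix ι ι ℝ, (∀ k l, |X k l| ≤ R) →
      (∀ p ∉ T, X p.1 p.2 = 0 ∨ |X p.1 p.2| = R) →
      Reach α R (cost S R) X (pairSum X + C) from
    H Finset.univ X hX fun p hp => absurd (Finset.mem_univ p) hp
  intro T
  induction T using Finset.induction_on with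
  | empty =>
    intro X _ hX
    exact reach_grid hα0 hα1 hR hs fun k l => hX (k, l) (Finset.notMem_empty _)
  | insert p T hpT ih =>
    obtain ⟨i, j⟩ := p
    intro X hX hXT
    set x := X i j with hx
    set P := X - Matrix.single i j x with hP
    have hPij : P i j = 0 := by simp [hP, hx]
    have hPne : ∀ k l, (k, l) ≠ (i, j) → P k l = X k l := by
      intro k l h
      have : ¬(i = k ∧ j = l) := fun h' => h (by simp [h'.1, h'.2])
      simp [hP, this]
    obtain ⟨d, hd, hdx⟩ : ∃ d : ℝ, |d| = R ∧ |x| / R * d = x := by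
      rcases le_total 0 x with h | h
      · exact ⟨R, abs_of_pos hR, by rw [abs_of_nonneg h]; field_simp⟩
      · exact ⟨-R, by rw [abs_neg, abs_of_pos hR], by rw [abs_of_nonpos h]; field_simp⟩
    set Q := P + Matrix.single i j d with hQ
    have hQij : Q i j = d := by simp [hQ, hPij]
    have hQne : ∀ k l, (k, l) ≠ (i, j) → Q k l = X k l := by
      intro k l h
      have : ¬(i = k ∧ j = l) := fun h' => h (by simp [h'.1, h'.2])
      simp [hQ, this, hPne k l h]
    have hPR : ∀ k l, |P k l| ≤ R := by
      intro k l
      by_cases h : (k, l) = (i, j)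
      · simp only [Prod.mk.injEq] at h
        rw [h.1, h.2, hPij, abs_zero]; exact hR.le
      · rw [hPne k l h]; exact hX k l
    have hQR : ∀ k l, |Q k l| ≤ R := by
      intro k l
      by_cases h : (k, l) = (i, j)
      · simp only [Prod.mk.injEq] at h
        rw [h.1, h.2, hQij, hd]
      · rw [hQne k l h]; exact hX k l
    have hPe := ih P hPR fun p hp => by
      by_cases h : p = (i, j)
      · rw [h]; exact Or.inl hPij
      · rw [hPne p.1 p.2 h]; exact hXT p (by simp [h, hp])
    have hQe := ih Q hQR fun p hp => by
      by_cases h : p = (i, j)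
      · rw [h]; exact Or.inr (by rw [hQij, hd])
      · rw [hQne p.1 p.2 h]; exact hXT p (by simp [h, hp])
    have hθ : |x| / R ∈ Icc (0 : ℝ) 1 := ⟨by positivity, (div_le_one hR).mpr (hX i j)⟩
    have key := Reach.interpolate hα0 hα1 hR (K := (Fintype.card ι : ℝ) ^ 4 * (2 * R) ^ 2)
      (by positivity) (fun Y hY => cost_le_of_bdd S hR.le (by linarith) hY) hPR hQR hPe hQe hθ
    have hXP : P + Matrix.single i j x = X := by simp [hP]
    have hval : pairSum X = pairSum P + 2 * (∑ p : ι × ι, |P p.1 p.2|) * |x| := by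
      rw [← pairSum_add_single hPij, hXP]
    rw [hdx, hXP] at key
    refine key.mono (le_of_eq ?_)
    rw [hQ, pairSum_add_single hPij, hval, hd]
    field_simp
    ring

end

section

variable [DecidableEq ι]

/-- The monomial matrix with permutation `σ` and coefficients `c`. -/
def monomialMatrix (σ : Equiv.Perm ι) (c : ι → ℝ) : Matrix ι ι ℝ :=
  fun k l => if σ k = l then c k else 0

lemma monomialMatrix_add_single (σ : Equiv.Perm ι) (c : ι → ℝ) (m : ι) (y : ℝ) :
    monomialMatrix σ c + Matrix.single m (σ m) y
      = monomialMatrix σ (Function.update c m (c m + y)) := by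
  ext k l
  simp only [Matrix.add_apply, monomialMatrix, Matrix.single_apply, Function.update_apply]
  by_cases h : k = m
  · subst h
    by_cases h' : σ k = l <;> simp [h']
  · have : ¬(m = k ∧ σ m = l) := fun h' => h h'.1.symm
    simp [h, this]

lemma monomialMatrix_single (σ : Equiv.Perm ι) (i : ι) (γ : ℝ) :
    monomialMatrix σ (Pi.single i γ) = Matrix.single i (σ i) γ := by
  ext k l
  simp only [monomialMatrix, Matrix.single_apply, Pi.single_apply]
  by_cases h : k = i
  · subst h; simp
  · simp [h, Ne.symm h]

lemma abs_monomialMatrix_le (σ : Equiv.Perm ι) {c : ι → ℝ} {R : ℝ} (hR : 0 ≤ R)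
    (hc : ∀ m, |c m| ≤ R) (k l : ι) : |monomialMatrix σ c k l| ≤ R := by
  simp only [monomialMatrix]
  split_ifs
  · exact hc k
  · simpa using hR

variable [Fintype ι]

lemma det_monomialMatrix (σ : Equiv.Perm ι) (c : ι → ℝ) :
    (monomialMatrix σ c).det = ((Equiv.Perm.sign σ : ℤ) : ℝ) * ∏ k, c k := by
  have : monomialMatrix σ c = Matrix.diagonal c * σ.permMatrix ℝ := by
    ext k l
    simp [monomialMatrix, Matrix.diagonal_mul, Equiv.toPEquiv, PEquiv.toMatrix_apply, eq_comm]
  rw [this, Matrix.det_mul, Matrix.det_diagonal, Matrix.det_permutation, mul_comm]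

variable [Nonempty ι] {α R : ℝ} {S : Set (Matrix ι ι ℝ)}

lemma reach_monomialMatrix (hα0 : 0 < α) (hα1 : α < 1) (hR : 1 ≤ R) (σ : Equiv.Perm ι)
    (hS : ∀ c : ι → ℝ, (monomialMatrix σ c).det = 1 → monomialMatrix σ c ∈ S)
    {i m : ι} (him : m ≠ i) {c : ι → ℝ} (hi : |c i| = R) (hm : c m = 0)
    (hc : ∀ k, k ≠ i → k ≠ m → |c k| = 1) :
    Reach α R (cost S R) (monomialMatrix σ c) (4 * (Fintype.card ι : ℝ) ^ 4) := by
  have hR0 : 0 < R := by linarith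
  set K := (Fintype.card ι : ℝ) ^ 4 * (2 * R) ^ 2 with hK
  have hK0 : 0 ≤ K := by positivity
  have hf : ∀ Y : Matrix ι ι ℝ, (∀ k l, |Y k l| ≤ 2 * R) → cost S R Y ≤ ENNReal.ofReal K :=
    fun Y hY => cost_le_of_bdd S hR0.le (by linarith) hY
  set t : ℝ := ((Equiv.Perm.sign σ : ℤ) : ℝ) * ∏ k ∈ Finset.univ \ {m}, c k with ht
  have hsign : |((Equiv.Perm.sign σ : ℤ) : ℝ)| = 1 := by
    rcases Int.units_eq_one_or (Equiv.Perm.sign σ) with h | h <;> simp [h]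
  have htR : |t| = R := by
    rw [ht, abs_mul, hsign, one_mul, Finset.abs_prod, Finset.prod_eq_single_of_mem i
      (by simp [him.symm]) (fun k hk hki => hc k hki (by simpa using hk)), hi]
  have ht0 : t ≠ 0 := fun h => by rw [h, abs_zero] at htR; linarith
  have ht2 : t ^ 2 = R ^ 2 := by rw [← sq_abs, htR]
  have hbd : ∀ s : ℝ, |s| ≤ R → ∀ k l, |monomialMatrix σ (Function.update c m s) k l| ≤ R := by
    intro s hs
    refine abs_monomialMatrix_le σ hR0.le fun k => ?_
    rw [Function.update_apply]
    split_ifs with h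
    · exact hs
    · by_cases h' : k = i
      · rw [h', hi]
      · rw [hc k h' h]; exact hR
  have hti : |t⁻¹| ≤ R := by
    rw [abs_inv, htR]
    exact (inv_le_one_of_one_le₀ hR).trans hR
  set P := monomialMatrix σ (Function.update c m t⁻¹) with hP
  have hPS : P ∈ S := by
    refine hS _ ?_
    rw [det_monomialMatrix, Finset.prod_update_of_mem (Finset.mem_univ m)]
    calc _ = t⁻¹ * t := by rw [ht]; ring
      _ = 1 := inv_mul_cancel₀ ht0
  have hQ : P + Matrix.single m (σ m) (-t - t⁻¹) = monomialMatrix σ (Function.update c m (-t)) := by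
    rw [hP, monomialMatrix_add_single]
    simp
  have hA : Reach α R (cost S R) P 0 :=
    Reach.of_le (fun k l => (hbd _ hti k l).trans (by linarith)) le_rfl (by simp [cost_of_mem hPS])
  have hQR := hbd (-t) (by rw [abs_neg, htR])
  have hB : Reach α R (cost S R) (P + Matrix.single m (σ m) (-t - t⁻¹)) K := by
    rw [hQ]
    have h2 : ∀ k l, |monomialMatrix σ (Function.update c m (-t)) k l| ≤ 2 * R :=
      fun k l => (hQR k l).trans (by linarith)
    exact Reach.of_le h2 hK0 (hf _ h2)
  have hθ : 1 / (1 + R ^ 2) ∈ Icc (0 : ℝ) 1 :=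
    ⟨by positivity, (div_le_one (by positivity)).mpr (by nlinarith)⟩
  have key := Reach.interpolate hα0 hα1 hR0 hK0 hf (hbd _ hti) (by rw [hQ]; exact hQR) hA hB hθ
  have e : P + Matrix.single m (σ m) (1 / (1 + R ^ 2) * (-t - t⁻¹)) = monomialMatrix σ c := by
    rw [hP, monomialMatrix_add_single]
    congr 1
    have : t⁻¹ + 1 / (1 + R ^ 2) * (-t - t⁻¹) = 0 := by
      rw [← ht2]
      have : (1 + t ^ 2) ≠ 0 := by positivity
      field_simp
      ring
    simp only [Function.update_self, Function.update_idem, this]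
    rw [← hm, Function.update_eq_self]
  rw [e] at key
  refine key.mono ?_
  rw [mul_zero, zero_add, hK, one_div, inv_mul_le_iff₀ (by positivity)]
  have : 0 ≤ (Fintype.card ι : ℝ) ^ 4 := by positivity
  nlinarith

lemma reach_single (hα0 : 0 < α) (hα1 : α < 1) (hR : 1 ≤ R) (σ : Equiv.Perm ι)
    (hS : ∀ c : ι → ℝ, (monomialMatrix σ c).det = 1 → monomialMatrix σ c ∈ S)
    {i m : ι} (him : m ≠ i) {γ : ℝ} (hγ : |γ| = R) :
    Reach α R (cost S R) (Matrix.single i (σ i) γ) (4 * (Fintype.card ι : ℝ) ^ 4) := by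
  have hR0 : 0 < R := by linarith
  suffices H : ∀ T : Finset ι, ∀ c : ι → ℝ, |c i| = R → c m = 0 →
      (∀ k ∈ T, k ≠ i → k ≠ m → c k = 0) → (∀ k ∉ T, k ≠ i → k ≠ m → |c k| = 1) →
      Reach α R (cost S R) (monomialMatrix σ c) (4 * (Fintype.card ι : ℝ) ^ 4) by
    rw [← monomialMatrix_single]
    exact H Finset.univ _ (by simpa using hγ) (by simp [him]) (fun k _ hk _ => by simp [hk])
      fun k hk => absurd (Finset.mem_univ k) hk
  intro T
  induction T using Finset.induction_on with
  | empty =>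
    intro c hi hm _ hc
    exact reach_monomialMatrix hα0 hα1 hR σ hS him hi hm fun k => hc k (Finset.notMem_empty k)
  | insert a T haT ih =>
    intro c hi hm h0 h1
    by_cases ha : a ≠ i ∧ a ≠ m
    · have hca : c a = 0 := h0 a (Finset.mem_insert_self a T) ha.1 ha.2
      have hb : ∀ s : ℝ, |s| = 1 → Reach α R (cost S R) (monomialMatrix σ c
          + Matrix.single a (σ a) s) (4 * (Fintype.card ι : ℝ) ^ 4) := by
        intro s hs
        rw [monomialMatrix_add_single, hca, zero_add]
        refine ih _ (by simpa [ha.1.symm] using hi) (by simpa [ha.2.symm] using hm)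
          (fun k hk hki hkm => ?_) fun k hk hki hkm => ?_
        · have : k ≠ a := fun h => haT (h ▸ hk)
          simpa [this] using h0 k (Finset.mem_insert_of_mem hk) hki hkm
        · by_cases hka : k = a
          · simpa [hka] using hs
          · simpa [hka] using h1 k (by simp [hka, hk]) hki hkm
      have := Reach.midpoint hα0 hα1 hR0 (K := (Fintype.card ι : ℝ) ^ 4 * (2 * R) ^ 2)
        (by positivity) (fun Y hY => cost_le_of_bdd S hR0.le (by linarith) hY)
        (X := monomialMatrix σ c) (abs_monomialMatrix_le σ hR0.le fun k => ?_)
        (hb 1 (by simp)) (hb (-1) (by simp))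
      · simpa using this
      · by_cases hki : k = i
        · rw [hki, hi]
        by_cases hkm : k = m
        · rw [hkm, hm, abs_zero]; exact hR0.le
        by_cases hk : k ∈ insert a T
        · rw [h0 k hk hki hkm, abs_zero]; exact hR0.le
        · rw [h1 k hk hki hkm]; exact hR
    · refine ih c hi hm (fun k hk => h0 k (Finset.mem_insert_of_mem hk)) fun k hk hki hkm => ?_
      exact h1 k (fun h => (Finset.mem_insert.mp h).elim
        (fun h => ha ⟨h ▸ hki, h ▸ hkm⟩) hk) hki hkm

end

lemma isLeft_swap {n : ℕ} {a b : Fin n ⊕ Fin n} (h : a.isLeft = b.isLeft) (k : Fin n ⊕ Fin n) :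
    (Equiv.swap a b k).isLeft = k.isLeft := by
  rw [Equiv.swap_apply_def]
  split_ifs with h1 h2
  · rw [h1, h]
  · rw [h2, h]
  · rfl

lemma exists_perm_split {n : ℕ} (i j : Fin n ⊕ Fin n) :
    ∃ σ : Equiv.Perm (Fin n ⊕ Fin n), σ i = j ∧ ∀ c, monomialMatrix σ c ∈ LSet n := by
  by_cases h : i.isLeft = j.isLeft
  · refine ⟨Equiv.swap i j, Equiv.swap_apply_left i j, fun c => Or.inl ⟨fun a b => ?_, fun a b => ?_⟩⟩
    all_goals
      refine if_neg fun h' => ?_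
      have := isLeft_swap h
      first
        | simpa [h'] using this (Sum.inl a)
        | simpa [h'] using this (Sum.inr a)
  · have h2 : i.swap.isLeft = j.isLeft := by
      cases i <;> cases j <;> simp_all
    refine ⟨(Equiv.sumComm _ _).trans (Equiv.swap i.swap j), by simp, fun c =>
      Or.inr ⟨fun a b => ?_, fun a b => ?_⟩⟩
    all_goals
      refine if_neg fun h' => ?_
      simp only [Equiv.trans_apply, Equiv.sumComm_apply, Sum.swap_inl, Sum.swap_inr] at h'
      have := isLeft_swap h2
      first
        | simpa [h'] using this (Sum.inl a)
        | simpa [h'] using this (Sum.inr a)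

/-- At every matrix of the cube of size `R`, the averaged cost can be made almost equal to the
pair sum, up to a constant independent of `R`. -/
lemma reach_split {n : ℕ} (hn : 0 < n) {α R : ℝ} (hα0 : 0 < α) (hα1 : α < 1) (hR : 1 ≤ R)
    {X : Matrix (Fin n ⊕ Fin n) (Fin n ⊕ Fin n) ℝ} (hX : ∀ k l, |X k l| ≤ R) :
    Reach α R (cost (LSet n ∩ SigmaSet n) R) X
      (pairSum X + 4 * (Fintype.card (Fin n ⊕ Fin n) : ℝ) ^ 4) := by
  have : Nonempty (Fin n ⊕ Fin n) := ⟨Sum.inl ⟨0, hn⟩⟩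
  refine reach_cube hα0 hα1 (by linarith) (fun i j γ hγ => ?_) hX
  obtain ⟨σ, rfl, hσ⟩ := exists_perm_split i j
  refine reach_single hα0 hα1 hR σ (S := LSet n ∩ SigmaSet n) (fun c hc => ⟨hσ c, hc⟩) (m := i.swap) ?_ hγ
  cases i <;> simp

section

variable [Fintype ι] [DecidableEq ι]

/-- Up to a null set, a condition on the gradient of an admissible perturbation is open. -/
lemma Adm.volume_diff_interior {α : ℝ} {D : Set (ι → ℝ)} (hD : IsOpen D) {v : (ι → ℝ) → ι → ℝ}
    {G : (ι → ℝ) → Matrix ι ι ℝ} (h : Adm α D v G) (p : Matrix ι ι ℝ → Prop) :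
    volume ({x | x ∈ D ∧ p (G x)} \ interior {x | x ∈ D ∧ p (G x)}) = 0 := by
  refine measure_mono_null ?_ (ae_iff.mp h.locAffine)
  rintro x ⟨⟨hxD, hpx⟩, hx⟩ hloc
  obtain ⟨ρ, hρ, hG⟩ := hloc hxD
  refine hx (mem_interior_iff_mem_nhds.mpr ?_)
  filter_upwards [hD.mem_nhds hxD, Metric.closedBall_mem_nhds x hρ] with y hy hy'
  exact ⟨hy, by rw [(hG y hy').1]; exact hpx⟩

lemma Adm.interior_ae_eq {α : ℝ} {D : Set (ι → ℝ)} (hD : IsOpen D) {v : (ι → ℝ) → ι → ℝ}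
    {G : (ι → ℝ) → Matrix ι ι ℝ} (h : Adm α D v G) (p : Matrix ι ι ℝ → Prop) :
    (interior {x | x ∈ D ∧ p (G x)} : Set (ι → ℝ)) =ᵐ[volume] {x | x ∈ D ∧ p (G x)} :=
  interior_subset.eventuallyLE.antisymm (ae_le_set.mpr (h.volume_diff_interior hD p))

lemma Adm.nullMeasurableSet {α : ℝ} {D : Set (ι → ℝ)} (hD : IsOpen D) {v : (ι → ℝ) → ι → ℝ}
    {G : (ι → ℝ) → Matrix ι ι ℝ} (h : Adm α D v G) (p : Matrix ι ι ℝ → Prop) :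
    NullMeasurableSet {x | x ∈ D ∧ p (G x)} :=
  isOpen_interior.measurableSet.nullMeasurableSet.congr (h.interior_ae_eq hD p)

lemma Adm.mul_volume_le {α : ℝ} {D : Set (ι → ℝ)} (hD : IsOpen D) {v : (ι → ℝ) → ι → ℝ}
    {G : (ι → ℝ) → Matrix ι ι ℝ} (h : Adm α D v G) (A : Matrix ι ι ℝ) (S : Set (Matrix ι ι ℝ))
    (R : ℝ) : ENNReal.ofReal (R ^ 2) * volume {x | x ∈ D ∧ A + G x ∉ S}
      ≤ ∫⁻ x in D, cost S R (A + G x) := by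
  rw [← measure_congr (h.interior_ae_eq hD fun Y => A + Y ∉ S), ← setLIntegral_const]
  refine (setLIntegral_mono' isOpen_interior.measurableSet fun x hx => ?_).trans
    (lintegral_mono_set (interior_subset.trans fun x hx => hx.1))
  rw [cost_of_notMem (interior_subset hx).2]
  exact ENNReal.ofReal_le_ofReal (le_max_right _ _)

variable [Nonempty ι]

lemma Adm.improve {α R C ε : ℝ} (hα0 : 0 < α) (hα1 : α < 1) (hR : 0 < R) (hC : 0 ≤ C)
    {S : Set (Matrix ι ι ℝ)}
    (hS : ∀ X : Matrix ι ι ℝ, (∀ k l, |X k l| ≤ R) → Reach α R (cost S R) X (pairSum X + C))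
    {D : Set (ι → ℝ)} (hD : IsOpen D) {v : (ι → ℝ) → ι → ℝ} {G : (ι → ℝ) → Matrix ι ι ℝ}
    (h : Adm α D v G) {A : Matrix ι ι ℝ} (hG : ∀ x k l, |A k l + G x k l| ≤ R) (hε : 0 < ε) :
    ∃ (v' : (ι → ℝ) → ι → ℝ) (G' : (ι → ℝ) → Matrix ι ι ℝ), Adm α D v' G' ∧
      (∀ x k l, |A k l + G' x k l| ≤ 2 * R) ∧
      (∀ x y, dist (v' x - v x) (v' y - v y) ≤ ε * dist x y ^ α) ∧
      (∀ x, A + G x ∈ S → G' x = G x) ∧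
      ∫⁻ x in D, cost S R (A + G' x) ≤
        ENNReal.ofReal (1 + 4 * (C + 1) / R ^ 2) * ∫⁻ x in D, cost S (R / 2) (A + G x) := by
  classical
  set B := Metric.ball (0 : ι → ℝ) 1 with hB
  have hB0 : volume B ≠ 0 := (Metric.measure_ball_pos volume _ one_pos).ne'
  have hBt : volume B ≠ ⊤ := measure_ball_lt_top.ne
  have hex : ∀ Y : Matrix ι ι ℝ, ∃ (w : (ι → ℝ) → ι → ℝ) (H : (ι → ℝ) → Matrix ι ι ℝ),
      Adm α B w H ∧ (∀ x k l, |H x k l| ≤ 3 * R) ∧ (A + Y ∈ S → H = 0) ∧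
      ((∀ k l, |A k l + Y k l| ≤ R) → (∀ x k l, |A k l + (Y k l + H x k l)| ≤ 2 * R) ∧
        (volume B)⁻¹ * ∫⁻ z in B, cost S R (A + (Y + H z)) ≤
          ENNReal.ofReal (1 + 4 * (C + 1) / R ^ 2) * cost S (R / 2) (A + Y)) := by
    intro Y
    by_cases hY : A + Y ∈ S
    · refine ⟨0, 0, Adm.zero_zero _, fun x k l => by simpa using hR.le, fun _ => rfl,
        fun hYR => ⟨fun x k l => ?_, ?_⟩⟩
      · simpa using (hYR k l).trans (by linarith)
      · simp [cost_of_mem hY]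
    by_cases hYR : ∀ k l, |A k l + Y k l| ≤ R
    · obtain ⟨w, H, hw, hH, hint⟩ := (hS (A + Y) hYR).2 (pairSum (A + Y) + C + 1) (by linarith)
      refine ⟨w, H, hw, fun x k l => ?_, fun h => absurd h hY, fun _ => ⟨fun x k l => ?_, ?_⟩⟩
      · have h1 := abs_sub ((A + Y) k l + H x k l) ((A + Y) k l)
        rw [add_sub_cancel_left] at h1
        have h2 := hH x k l
        have h3 := hYR k l
        rw [Matrix.add_apply] at *
        linarith
      · rw [← add_assoc]; exact hH x k l
      · simp only [← add_assoc]
        calc (volume B)⁻¹ * ∫⁻ z in B, cost S R (A + Y + H z)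
            ≤ (volume B)⁻¹ * (ENNReal.ofReal (pairSum (A + Y) + C + 1) * volume B) := by gcongr
          _ = ENNReal.ofReal (pairSum (A + Y) + C + 1) := by
            rw [mul_comm, mul_assoc, ENNReal.mul_inv_cancel hB0 hBt, mul_one]
          _ ≤ _ := by
            rw [cost_of_notMem hY, ← ENNReal.ofReal_mul (by positivity)]
            refine ENNReal.ofReal_le_ofReal ?_
            have h1 := le_max_left (pairSum (A + Y)) ((R / 2) ^ 2)
            have h2 := le_max_right (pairSum (A + Y)) ((R / 2) ^ 2)
            set m := max (pairSum (A + Y)) ((R / 2) ^ 2)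
            have h3 : C + 1 ≤ 4 * (C + 1) / R ^ 2 * m := by
              calc C + 1 = 4 * (C + 1) / R ^ 2 * (R / 2) ^ 2 := by field_simp; ring
                _ ≤ _ := by gcongr
            linarith
    · exact ⟨0, 0, Adm.zero_zero _, fun x k l => by simpa using hR.le, fun _ => rfl,
        fun h => absurd h hYR⟩
  choose V H hV hHb hH0 hH using hex
  obtain ⟨v', G', hv', hinc, hG', hint⟩ := h.compose hα0 hα1 hD hV hHb hε
  refine ⟨v', G', hv', fun x k l => ?_, hinc, fun x hx => ?_, ?_⟩
  · obtain ⟨z, hz⟩ := hG' x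
    rw [hz]
    exact (hH (G x) (hG x)).1 z k l
  · obtain ⟨z, hz⟩ := hG' x
    rw [hz, hH0 _ hx]
    simp
  · rw [hint fun Y => cost S R (A + Y), ← lintegral_const_mul' _ _ ENNReal.ofReal_ne_top]
    exact lintegral_mono fun x => (hH (G x) (hG x)).2

/-- A sequence of admissible perturbations whose gradients approach `S`. -/
structure ApproxSeq (α ε r T : ℝ) (D : Set (ι → ℝ)) (S : Set (Matrix ι ι ℝ)) (A : Matrix ι ι ℝ)
    (v : ℕ → (ι → ℝ) → ι → ℝ) (G : ℕ → (ι → ℝ) → Matrix ι ι ℝ) : Prop where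
  v_zero : v 0 = 0
  adm : ∀ k, Adm α D (v k) (G k)
  bdd : ∀ k x i j, |A i j + G k x i j| ≤ 2 ^ k * r
  inc : ∀ k x y, dist (v (k + 1) x - v k x) (v (k + 1) y - v k y) ≤ ε / 2 / 2 ^ k * dist x y ^ α
  stay : ∀ k x, A + G k x ∈ S → G (k + 1) x = G k x
  volume_le : ∀ k, volume {x | x ∈ D ∧ A + G k x ∉ S} ≤ ENNReal.ofReal (T / 4 ^ k) * volume D

lemma exists_dependent_seq {X : Type*} (P : ℕ → X → Prop) (Q : ℕ → X → X → Prop) {x : X}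
    (hx : P 0 x) (h : ∀ k x, P k x → ∃ y, P (k + 1) y ∧ Q k x y) :
    ∃ s : ℕ → X, s 0 = x ∧ (∀ k, P k (s k)) ∧ ∀ k, Q k (s k) (s (k + 1)) := by
  have : Nonempty X := ⟨x⟩
  choose! F hF using h
  set s : ℕ → X := fun k => Nat.rec x (fun k y => F k y) k with hs
  have hP : ∀ k, P k (s k) := by
    intro k
    induction k with
    | zero => exact hx
    | succ k ih => exact (hF k _ ih).1
  exact ⟨s, rfl, hP, fun k => (hF k _ (hP k)).2⟩

lemma exists_approxSeq {α C ε r : ℝ} (hα0 : 0 < α) (hα1 : α < 1) (hC : 0 ≤ C)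
    {S : Set (Matrix ι ι ℝ)} (hS : ∀ R : ℝ, 1 ≤ R → ∀ X : Matrix ι ι ℝ, (∀ k l, |X k l| ≤ R) →
      Reach α R (cost S R) X (pairSum X + C))
    {D : Set (ι → ℝ)} (hD : IsOpen D) {A : Matrix ι ι ℝ} (hr : 1 ≤ r) (hA : ∀ k l, |A k l| ≤ r)
    (hε : 0 < ε) : ∃ v G,
      ApproxSeq α ε r (4 * Real.exp (8 * (C + 1)) * (Fintype.card ι : ℝ) ^ 4) D S A v G := by
  have hrk : ∀ k : ℕ, 1 ≤ 2 ^ k * r := fun k => one_le_mul_of_one_le_of_one_le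
    (one_le_pow₀ one_le_two) hr
  obtain ⟨s, hs0, hP, hQ⟩ := exists_dependent_seq
    (X := ((ι → ℝ) → ι → ℝ) × ((ι → ℝ) → Matrix ι ι ℝ))
    (fun k p => Adm α D p.1 p.2 ∧ ∀ x i j, |A i j + p.2 x i j| ≤ 2 ^ k * r)
    (fun k p q => (∀ x y, dist (q.1 x - p.1 x) (q.1 y - p.1 y) ≤ ε / 2 / 2 ^ k * dist x y ^ α) ∧
      (∀ x, A + p.2 x ∈ S → q.2 x = p.2 x) ∧
      ∫⁻ x in D, cost S (2 ^ (k + 1) * r / 2) (A + q.2 x) ≤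
        ENNReal.ofReal (1 + 4 * (C + 1) / (2 ^ k * r) ^ 2) *
          ∫⁻ x in D, cost S (2 ^ k * r / 2) (A + p.2 x))
    (x := (0, 0)) ⟨Adm.zero_zero D, fun x i j => by simpa using hA i j⟩
    (by
      rintro k ⟨v, G⟩ ⟨hv, hG⟩
      obtain ⟨v', G', h1, h2, h3, h4, h5⟩ := hv.improve hα0 hα1
        (zero_lt_one.trans_le (hrk k)) hC (hS _ (hrk k)) hD hG
        (show 0 < ε / 2 / 2 ^ k by positivity)
      refine ⟨(v', G'), ⟨h1, fun x i j => (h2 x i j).trans_eq (by ring)⟩, h3, h4, ?_⟩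
      rw [show (2 : ℝ) ^ (k + 1) * r / 2 = 2 ^ k * r by ring]
      exact h5)
  set c := 4 * (C + 1) with hc
  have hc0 : 0 ≤ c := by positivity
  set I : ℕ → ENNReal := fun k => ∫⁻ x in D, cost S (2 ^ k * r / 2) (A + (s k).2 x) with hI
  have hI0 : I 0 ≤ ENNReal.ofReal ((Fintype.card ι : ℝ) ^ 4 * r ^ 2) * volume D := by
    rw [← setLIntegral_const]
    refine lintegral_mono fun x => cost_le_of_bdd S (by linarith [hrk 0]) (by
      rw [pow_zero]; linarith) fun k l => ?_
    simpa [hs0] using hA k l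
  have hIk : ∀ k, I k ≤ ENNReal.ofReal (Real.exp (2 * c - 2 * c / 2 ^ k)) * I 0 := by
    intro k
    induction k with
    | zero => simp
    | succ k ih =>
      refine (hQ k).2.2.trans ?_
      refine (mul_le_mul_right ih _).trans ?_
      rw [← mul_assoc, ← ENNReal.ofReal_mul (by positivity)]
      gcongr
      have h1 : 1 + c / (2 ^ k * r) ^ 2 ≤ Real.exp (c / 2 ^ k) := by
        have h2 : c / (2 ^ k * r) ^ 2 ≤ c / 2 ^ k := by
          refine div_le_div_of_nonneg_left hc0 (by positivity) ?_
          have h3 : (1 : ℝ) ≤ 2 ^ k := one_le_pow₀ one_le_two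
          nlinarith [mul_le_mul_of_nonneg_left hr (by positivity : (0 : ℝ) ≤ 2 ^ k)]
        linarith [Real.add_one_le_exp (c / 2 ^ k)]
      calc (1 + c / (2 ^ k * r) ^ 2) * Real.exp (2 * c - 2 * c / 2 ^ k)
          ≤ Real.exp (c / 2 ^ k) * Real.exp (2 * c - 2 * c / 2 ^ k) := by gcongr
        _ = _ := by
          rw [← Real.exp_add]
          congr 1
          rw [pow_succ]
          field_simp
          ring
  refine ⟨fun k => (s k).1, fun k => (s k).2, by simp [hs0], fun k => (hP k).1,
    fun k => (hP k).2, fun k => (hQ k).1, fun k => (hQ k).2.1, fun k => ?_⟩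
  have hrk0 : 0 < 2 ^ k * r / 2 := by linarith [hrk k]
  have h1 := ((hP k).1.mul_volume_le hD A S (2 ^ k * r / 2)).trans (hIk k)
  have h2 : ENNReal.ofReal ((2 ^ k * r / 2) ^ 2) * volume {x | x ∈ D ∧ A + (s k).2 x ∉ S} ≤
      ENNReal.ofReal (Real.exp (2 * c)) *
        (ENNReal.ofReal ((Fintype.card ι : ℝ) ^ 4 * r ^ 2) * volume D) := by
    refine h1.trans ?_
    gcongr
    have : 0 ≤ 2 * c / 2 ^ k := by positivity
    linarith
  have hq : ENNReal.ofReal ((2 ^ k * r / 2) ^ 2) ≠ 0 := by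
    rw [Ne, ENNReal.ofReal_eq_zero, not_le]; positivity
  rw [mul_comm, ← ENNReal.le_div_iff_mul_le (Or.inl hq) (Or.inl ENNReal.ofReal_ne_top)] at h2
  refine h2.trans_eq ?_
  rw [← mul_assoc, ← ENNReal.ofReal_mul (Real.exp_pos _).le, mul_comm, mul_div_assoc,
    ← ENNReal.ofReal_div_of_pos (by positivity), mul_comm]
  congr 2
  have : (4 : ℝ) ^ k = (2 ^ k) ^ 2 := by rw [← pow_mul, mul_comm, pow_mul]; norm_num
  rw [this, hc, show 2 * (4 * (C + 1)) = 8 * (C + 1) by ring]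
  have : r ≠ 0 := by linarith
  field_simp
  ring

end

section

variable [Fintype ι]

lemma abs_le_frobNorm (X : Matrix ι ι ℝ) (k l : ι) : |X k l| ≤ frobNorm X := by
  refine Real.abs_le_sqrt ?_
  calc X k l ^ 2 ≤ ∑ i, X k i ^ 2 :=
        Finset.single_le_sum (f := fun i => X k i ^ 2) (fun _ _ => sq_nonneg _) (Finset.mem_univ l)
    _ ≤ _ := Finset.single_le_sum (f := fun k => ∑ i, X k i ^ 2)
        (fun _ _ => Finset.sum_nonneg fun _ _ => sq_nonneg _) (Finset.mem_univ k)

lemma frobNorm_nonneg (X : Matrix ι ι ℝ) : 0 ≤ frobNorm X := Real.sqrt_nonneg _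

lemma frobNorm_le {X : Matrix ι ι ℝ} {r : ℝ} (hr : 0 ≤ r) (h : ∀ k l, |X k l| ≤ r) :
    frobNorm X ≤ Fintype.card ι * r := by
  refine Real.sqrt_le_iff.mpr ⟨by positivity, ?_⟩
  calc ∑ k, ∑ i, X k i ^ 2 ≤ ∑ _k : ι, ∑ _i : ι, r ^ 2 :=
        Finset.sum_le_sum fun k _ => Finset.sum_le_sum fun i _ => sq_le_sq.mpr (by
          rw [abs_of_nonneg hr]; exact h k i)
    _ = _ := by simp only [Finset.sum_const, Finset.card_univ, nsmul_eq_mul]; ring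

lemma exists_bounded_dist_compl [Nonempty ι] {D : Set (ι → ℝ)} (hD : Bornology.IsBounded D) :
    ∃ ρ : ℝ, 0 < ρ ∧ ∀ x ∈ D, ∃ y ∉ D, dist x y ≤ ρ := by
  obtain ⟨R, hR⟩ := hD.subset_closedBall (0 : ι → ℝ)
  have hR1 : 0 < |R| + 1 := by positivity
  refine ⟨2 * (|R| + 1), by positivity, fun x hx => ⟨fun _ => |R| + 1, fun hy => ?_, ?_⟩⟩
  · have := hR hy
    rw [Metric.mem_closedBall, dist_zero_right, pi_norm_const, Real.norm_eq_abs,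
      abs_of_pos hR1] at this
    linarith [le_abs_self R]
  · have h1 : dist x 0 ≤ R := hR hx
    have h2 := dist_triangle x 0 (fun _ : ι => |R| + 1)
    rw [dist_zero_left, pi_norm_const, Real.norm_eq_abs, abs_of_pos hR1] at h2
    linarith [le_abs_self R]

end

section

variable [Fintype ι] [DecidableEq ι] {α ε r T : ℝ} {D : Set (ι → ℝ)} {S : Set (Matrix ι ι ℝ)}
  {A : Matrix ι ι ℝ} {v : ℕ → (ι → ℝ) → ι → ℝ} {G : ℕ → (ι → ℝ) → Matrix ι ι ℝ}

lemma ApproxSeq.stay_of_le (h : ApproxSeq α ε r T D S A v G) {k : ℕ} {x : ι → ℝ}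
    (hx : A + G k x ∈ S) {j : ℕ} (hj : k ≤ j) : G j x = G k x := by
  induction j, hj using Nat.le_induction with
  | base => rfl
  | succ j _ ih => rw [h.stay j x (by rwa [ih]), ih]

lemma ApproxSeq.ae_exists_mem (h : ApproxSeq α ε r T D S A v G) (hD : volume D ≠ ⊤) :
    ∀ᵐ x, x ∈ D → ∃ k, A + G k x ∈ S := by
  have hlim : Tendsto (fun k : ℕ => ENNReal.ofReal (T / 4 ^ k) * volume D) atTop
      (𝓝 (ENNReal.ofReal 0 * volume D)) := by
    refine ENNReal.Tendsto.mul_const (ENNReal.tendsto_ofReal ?_) (Or.inr hD)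
    exact tendsto_const_nhds.div_atTop (tendsto_pow_atTop_atTop_of_one_lt (by norm_num))
  rw [ENNReal.ofReal_zero, zero_mul] at hlim
  refine measure_mono_null (t := ⋂ k, {x | x ∈ D ∧ A + G k x ∉ S}) (fun x hx => ?_) ?_
  · simp only [mem_compl_iff, mem_ofPred_eq, not_forall, not_exists] at hx
    obtain ⟨hxD, hx⟩ := hx
    exact mem_iInter.mpr fun k => ⟨hxD, hx k⟩
  · refine le_antisymm (ge_of_tendsto' hlim fun k => ?_) zero_le
    exact (measure_mono (iInter_subset _ k)).trans (h.volume_le k)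

lemma ApproxSeq.ae_eventually_const (h : ApproxSeq α ε r T D S A v G) (hD : volume D ≠ ⊤) :
    ∀ᵐ x, ∃ k, ∀ j ≥ k, G j x = G k x := by
  filter_upwards [h.ae_exists_mem hD] with x hx
  by_cases hxD : x ∈ D
  · obtain ⟨k, hk⟩ := hx hxD
    exact ⟨k, fun j hj => h.stay_of_le hk hj⟩
  · exact ⟨0, fun j _ => by rw [(h.adm j).grad_zero x hxD, (h.adm 0).grad_zero x hxD]⟩

/-- A function dominating the `p`-th powers of the gradient norms of an approximating sequence. -/
def dominator (r p : ℝ) (D : Set (ι → ℝ)) (S : Set (Matrix ι ι ℝ)) (A : Matrix ι ι ℝ)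
    (G : ℕ → (ι → ℝ) → Matrix ι ι ℝ) (x : ι → ℝ) : ENNReal :=
  D.indicator (fun _ => ENNReal.ofReal ((Fintype.card ι * r) ^ p)) x +
    ∑' m : ℕ, {x | x ∈ D ∧ A + G m x ∉ S}.indicator
      (fun _ => ENNReal.ofReal ((Fintype.card ι * (2 ^ (m + 1) * r)) ^ p)) x

lemma ApproxSeq.le_dominator (h : ApproxSeq α ε r T D S A v G) (hr : 0 ≤ r) {p : ℝ} (hp : 0 ≤ p)
    {x : ι → ℝ} (hx : x ∈ D) (j : ℕ) :
    ENNReal.ofReal (frobNorm (A + G j x) ^ p) ≤ dominator r p D S A G x := by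
  have hle : ∀ k, ENNReal.ofReal (frobNorm (A + G k x) ^ p)
      ≤ ENNReal.ofReal ((Fintype.card ι * (2 ^ k * r)) ^ p) := fun k =>
    ENNReal.ofReal_le_ofReal (Real.rpow_le_rpow (frobNorm_nonneg _)
      (frobNorm_le (by positivity) (h.bdd k x)) hp)
  induction j with
  | zero =>
    refine (hle 0).trans ?_
    rw [dominator, indicator_of_mem hx, pow_zero, one_mul]
    exact le_self_add
  | succ j ih =>
    by_cases hj : A + G j x ∈ S
    · rwa [h.stay j x hj]
    · refine (hle (j + 1)).trans (le_trans ?_ le_add_self)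
      refine le_trans ?_ (ENNReal.le_tsum j)
      rw [indicator_of_mem (show x ∈ {x | x ∈ D ∧ A + G j x ∉ S} from ⟨hx, hj⟩)]

lemma ApproxSeq.aemeasurable_dominator (h : ApproxSeq α ε r T D S A v G) (hD : IsOpen D)
    (p : ℝ) : AEMeasurable (dominator r p D S A G) :=
  (aemeasurable_const.indicator hD.measurableSet).add <| AEMeasurable.tsum fun m =>
    aemeasurable_const.indicator₀ ((h.adm m).nullMeasurableSet hD fun Y => A + Y ∉ S)

lemma ApproxSeq.lintegral_dominator (h : ApproxSeq α ε r T D S A v G) (hD : IsOpen D)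
    (hD' : volume D ≠ ⊤) (hr : 0 ≤ r) {p : ℝ} (hp : p < 2) :
    ∫⁻ x, dominator r p D S A G x ≠ ⊤ := by
  have hm : ∀ m, NullMeasurableSet {x | x ∈ D ∧ A + G m x ∉ S} := fun m =>
    (h.adm m).nullMeasurableSet hD fun Y => A + Y ∉ S
  unfold dominator
  rw [lintegral_add_left (measurable_const.indicator hD.measurableSet),
    lintegral_tsum fun m => aemeasurable_const.indicator₀ (hm m),
    lintegral_indicator_const hD.measurableSet]
  refine ENNReal.add_ne_top.mpr ⟨ENNReal.mul_ne_top ENNReal.ofReal_ne_top hD', ?_⟩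
  set q : ℝ := 2 ^ p / 4 with hq
  have hq0 : 0 ≤ q := by positivity
  have hq1 : q < 1 := by
    rw [hq, div_lt_one (by norm_num)]
    calc (2 : ℝ) ^ p < 2 ^ (2 : ℝ) := Real.rpow_lt_rpow_of_exponent_lt (by norm_num) hp
      _ = 4 := by norm_num
  have hterm : ∀ m : ℕ, ∫⁻ x, {x | x ∈ D ∧ A + G m x ∉ S}.indicator
      (fun _ => ENNReal.ofReal ((Fintype.card ι * (2 ^ (m + 1) * r)) ^ p)) x
      ≤ ENNReal.ofReal ((Fintype.card ι * (2 * r)) ^ p * T * q ^ m) * volume D := by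
    intro m
    rw [lintegral_indicator_const₀ (hm m)]
    refine (mul_le_mul_right (h.volume_le m) _).trans_eq ?_
    rw [← mul_assoc, ← ENNReal.ofReal_mul (by positivity)]
    congr 2
    rw [hq, div_pow, ← Real.rpow_natCast (2 ^ p) m, ← Real.rpow_mul (by norm_num), mul_comm p,
      Real.rpow_mul (by norm_num), Real.rpow_natCast,
      show (Fintype.card ι : ℝ) * (2 ^ (m + 1) * r) = Fintype.card ι * (2 * r) * 2 ^ m by ring,
      Real.mul_rpow (by positivity) (by positivity)]
    ring
  refine ne_top_of_le_ne_top ?_ (ENNReal.tsum_le_tsum hterm)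
  rw [ENNReal.tsum_mul_right]
  exact ENNReal.mul_ne_top
    ((summable_geometric_of_lt_one hq0 hq1).mul_left _).tsum_ofReal_ne_top hD'

lemma ApproxSeq.exists_gradient (h : ApproxSeq α ε r T D S A v G) (hD : volume D ≠ ⊤) :
    ∃ F : (ι → ℝ) → Matrix ι ι ℝ, (∀ k x, A + G k x ∈ S → F x = G k x) ∧
      ∀ᵐ x, ∃ k, ∀ j ≥ k, G j x = F x := by
  classical
  refine ⟨fun x => if hx : ∃ k, ∀ j ≥ k, G j x = G k x then G hx.choose x else 0,
    fun k x hk => ?_, ?_⟩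
  · have hx : ∃ k, ∀ j ≥ k, G j x = G k x := ⟨k, fun j hj => h.stay_of_le hk hj⟩
    simp only [dif_pos hx]
    rw [← hx.choose_spec (max hx.choose k) (le_max_left _ _),
      h.stay_of_le hk (le_max_right _ _)]
  · filter_upwards [h.ae_eventually_const hD] with x hx
    simp only [dif_pos hx]
    exact ⟨hx.choose, hx.choose_spec⟩

lemma ApproxSeq.exists_limit [Nonempty ι] (h : ApproxSeq α ε r T D S A v G) (hα : 0 < α)
    (hε : 0 < ε) (hD : Bornology.IsBounded D) :
    ∃ w : (ι → ℝ) → ι → ℝ, (∀ x y, dist (w x) (w y) ≤ ε * dist x y ^ α) ∧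
      (∀ x, x ∉ D → w x = 0) ∧ ∃ B, ∀ k x, dist (v k x) (w x) ≤ B / 2 ^ k := by
  obtain ⟨ρ, hρ, hρD⟩ := exists_bounded_dist_compl hD
  set B := ε * ρ ^ α with hB
  have hinc : ∀ x k, dist (v k x) (v (k + 1) x) ≤ B / 2 / 2 ^ k := by
    intro x k
    by_cases hx : x ∈ D
    · obtain ⟨y, hy, hxy⟩ := hρD x hx
      have h1 := h.inc k x y
      rw [(h.adm k).zero y hy, (h.adm (k + 1)).zero y hy, sub_zero, dist_zero_right,
        ← dist_eq_norm, dist_comm] at h1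
      refine h1.trans ?_
      calc ε / 2 / 2 ^ k * dist x y ^ α ≤ ε / 2 / 2 ^ k * ρ ^ α := by gcongr
        _ = _ := by rw [hB]; ring
    · rw [(h.adm k).zero x hx, (h.adm (k + 1)).zero x hx, dist_self]
      positivity
  choose w hw using fun x => cauchySeq_tendsto_of_complete (cauchySeq_of_le_geometric_two (hinc x))
  refine ⟨w, fun x y => ?_, fun x hx => ?_, B, fun k x =>
    dist_le_of_le_geometric_two_of_tendsto (hinc x) (hw x) k⟩
  · have hk : ∀ k, dist (v k x) (v k y) ≤ ε * (1 - 1 / 2 ^ k) * dist x y ^ α := by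
      intro k
      induction k with
      | zero => simp [h.v_zero]
      | succ k ih =>
        have h1 := h.inc k x y
        have h2 : dist (v (k + 1) x) (v (k + 1) y) ≤
            dist (v k x) (v k y) + dist (v (k + 1) x - v k x) (v (k + 1) y - v k y) := by
          have := dist_add_add_le (v k x) (v (k + 1) x - v k x) (v k y) (v (k + 1) y - v k y)
          simpa using this
        calc _ ≤ ε * (1 - 1 / 2 ^ k) * dist x y ^ α + ε / 2 / 2 ^ k * dist x y ^ α := by linarith
          _ = _ := by
            rw [pow_succ]
            field_simp
            ring
    refine le_of_tendsto' ((hw x).dist (hw y)) fun k => (hk k).trans ?_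
    have h3 : 0 ≤ 1 / (2 : ℝ) ^ k := by positivity
    gcongr
    nlinarith
  · refine tendsto_nhds_unique (hw x) ?_
    simp only [fun k => (h.adm k).zero x hx]
    exact tendsto_const_nhds

end

lemma ae_tendsto_of_eventually_const [Fintype ι] {G : ℕ → (ι → ℝ) → Matrix ι ι ℝ}
    {F : (ι → ℝ) → Matrix ι ι ℝ} (hF : ∀ᵐ x, ∃ k, ∀ j ≥ k, G j x = F x) :
    ∀ᵐ x, ∀ k l, Tendsto (fun j => G j x k l) atTop (𝓝 (F x k l)) := by
  filter_upwards [hF] with x ⟨m, hm⟩ k l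
  exact tendsto_const_nhds.congr' (by
    filter_upwards [eventually_ge_atTop m] with j hj
    rw [hm j hj])

section

variable [Fintype ι] [DecidableEq ι] {α ε r T : ℝ} {D : Set (ι → ℝ)} {S : Set (Matrix ι ι ℝ)}
  {A : Matrix ι ι ℝ} {v : ℕ → (ι → ℝ) → ι → ℝ} {G : ℕ → (ι → ℝ) → Matrix ι ι ℝ}
  {F : (ι → ℝ) → Matrix ι ι ℝ}

lemma ApproxSeq.aemeasurable_limit (h : ApproxSeq α ε r T D S A v G)
    (hF : ∀ᵐ x, ∃ k, ∀ j ≥ k, G j x = F x) (k l : ι) : AEMeasurable fun x => F x k l :=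
  aemeasurable_of_tendsto_metrizable_ae atTop (fun j => (h.adm j).meas k l)
    ((ae_tendsto_of_eventually_const hF).mono fun _ hx => hx k l)

lemma ApproxSeq.integrableOn_limit (h : ApproxSeq α ε r T D S A v G) (hD : IsOpen D)
    (hD' : volume D ≠ ⊤) (hr : 0 ≤ r) (hF : ∀ᵐ x, ∃ k, ∀ j ≥ k, G j x = F x) {p : ℝ}
    (hp0 : 0 ≤ p) (hp : p < 2) : IntegrableOn (fun x => frobNorm (A + F x) ^ p) D := by
  refine (integrable_toReal_of_lintegral_ne_top (h.aemeasurable_dominator hD p)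
    (h.lintegral_dominator hD hD' hr hp)).integrableOn.mono' ?_ ?_
  · refine (AEMeasurable.pow_const ?_ p).aestronglyMeasurable.restrict
    exact (Finset.aemeasurable_fun_sum _ fun k _ => Finset.aemeasurable_fun_sum _ fun l _ =>
      ((h.aemeasurable_limit hF k l).const_add _).pow_const 2).sqrt
  · filter_upwards [ae_restrict_of_ae hF, ae_restrict_mem hD.measurableSet, ae_restrict_of_ae
      (ae_lt_top' (h.aemeasurable_dominator hD p) (h.lintegral_dominator hD hD' hr hp))]
      with x ⟨k, hk⟩ hx hlt
    rw [Real.norm_of_nonneg (Real.rpow_nonneg (frobNorm_nonneg _) _),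
      ← ENNReal.ofReal_le_iff_le_toReal hlt.ne, ← hk k le_rfl]
    exact h.le_dominator hr hp0 hx k

lemma ApproxSeq.volume_limit_le (h : ApproxSeq α ε r T D S A v G) (hr : 0 < r) (hT : 0 ≤ T)
    [Nonempty ι] (hF : ∀ k x, A + G k x ∈ S → F x = G k x) {t : ℝ} (ht : 0 < t) :
    volume {x | x ∈ D ∧ t < frobNorm (A + F x)} ≤
      ENNReal.ofReal (4 * Fintype.card ι ^ 2 * (T + 1) * r ^ 2 * t ^ (-2 : ℝ)) * volume D := by
  have hN : (0 : ℝ) < Fintype.card ι := by exact_mod_cast Fintype.card_pos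
  set N : ℝ := (Fintype.card ι : ℝ) with hNdef
  have htp : t ^ (-2 : ℝ) = (t ^ 2)⁻¹ := by
    rw [Real.rpow_neg ht.le, ← Real.rpow_natCast]; norm_num
  rw [htp]
  rcases lt_or_ge t (N * r) with hlt | hge
  · refine (measure_mono fun x hx => hx.1).trans (le_mul_of_one_le_left zero_le ?_)
    rw [ENNReal.one_le_ofReal, ← div_eq_mul_inv, one_le_div (by positivity)]
    calc t ^ 2 ≤ (N * r) ^ 2 := by gcongr
      _ ≤ 4 * N ^ 2 * (T + 1) * r ^ 2 := by
        have : 0 ≤ N ^ 2 * r ^ 2 := by positivity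
        nlinarith [mul_nonneg hT this]
  · obtain ⟨k, hk1, hk2⟩ := exists_nat_pow_near (x := t / (N * r)) (y := 2)
      ((one_le_div (by positivity)).mpr hge) one_lt_two
    rw [le_div_iff₀ (by positivity)] at hk1
    rw [div_lt_iff₀ (by positivity)] at hk2
    refine (measure_mono (t := {x | x ∈ D ∧ A + G k x ∉ S}) fun x hx => ⟨hx.1, fun hS => ?_⟩).trans
      ((h.volume_le k).trans ?_)
    · have h1 := hx.2
      rw [hF k x hS] at h1
      have h2 : frobNorm (A + G k x) ≤ N * (2 ^ k * r) := frobNorm_le (by positivity) (h.bdd k x)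
      have h3 : N * (2 ^ k * r) = 2 ^ k * (N * r) := by ring
      linarith
    · gcongr
      rw [← div_eq_mul_inv, div_le_div_iff₀ (by positivity) (by positivity)]
      have h4 : t ^ 2 ≤ 4 * N ^ 2 * r ^ 2 * 4 ^ k := by
        calc t ^ 2 ≤ (2 ^ (k + 1) * (N * r)) ^ 2 := by gcongr
          _ = _ := by
            rw [show (4 : ℝ) ^ k = (2 ^ k) ^ 2 by rw [← pow_mul, mul_comm, pow_mul]; norm_num]
            ring
      calc T * t ^ 2 ≤ (T + 1) * (4 * N ^ 2 * r ^ 2 * 4 ^ k) := by gcongr; linarith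
        _ = _ := by ring

lemma ApproxSeq.weak_limit (h : ApproxSeq α ε r T D S A v G) (hα : 0 < α) (hD : IsOpen D)
    (hD' : volume D ≠ ⊤) (hr : 0 ≤ r) (hF : ∀ᵐ x, ∃ k, ∀ j ≥ k, G j x = F x)
    {w : (ι → ℝ) → ι → ℝ} {B : ℝ} (hw : ∀ k x, dist (v k x) (w x) ≤ B / 2 ^ k)
    {φ : (ι → ℝ) → ℝ} (hφ : ∀ n : ℕ, ContDiff ℝ n φ) (hc : HasCompactSupport φ) (k l : ι) :
    ∫ x, w x k * fderiv ℝ φ x (Pi.single l 1) = - ∫ x, F x k l * φ x := by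
  have hB : 0 ≤ B := by simpa using dist_nonneg.trans (hw 0 0)
  obtain ⟨hd1, hd2⟩ := integrable_fderiv_apply hφ hc (Pi.single l (1 : ℝ))
  have hwk : ∀ j x, |v j x k - w x k| ≤ B / 2 ^ j := fun j x => by
    rw [← Real.dist_eq]; exact (dist_le_pi_dist _ _ k).trans (hw j x)
  have hB2 : Tendsto (fun j : ℕ => B / 2 ^ j) atTop (𝓝 0) :=
    tendsto_const_nhds.div_atTop (tendsto_pow_atTop_atTop_of_one_lt (by norm_num))
  have hv : ∀ j, Continuous fun x => v j x k := fun j =>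
    (continuous_apply k).comp ((h.adm j).continuous hα)
  have hlim1 : Tendsto (fun j => ∫ x, v j x k * fderiv ℝ φ x (Pi.single l 1)) atTop
      (𝓝 (∫ x, w x k * fderiv ℝ φ x (Pi.single l 1))) := by
    refine tendsto_integral_of_dominated_convergence
      (fun x => (2 * B) * |fderiv ℝ φ x (Pi.single l 1)|) (fun j => ((hv j).mul hd1).aestronglyMeasurable)
      ((hd1.integrable_of_hasCompactSupport hd2).abs.const_mul _) (fun j => ae_of_all _ fun x => ?_)
      (ae_of_all _ fun x => ?_)
    · rw [Real.norm_eq_abs, abs_mul]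
      gcongr
      have h1 := hwk j x
      have h2 := hwk 0 x
      have h3 : B / 2 ^ j ≤ B := div_le_self hB (one_le_pow₀ one_le_two)
      rw [h.v_zero, pow_zero, div_one] at h2
      simp only [Pi.zero_apply, zero_sub, abs_neg] at h2
      calc |v j x k| = |(v j x k - w x k) + w x k| := by rw [sub_add_cancel]
        _ ≤ _ := (abs_add_le _ _).trans (by linarith)
    · refine Tendsto.mul_const _ ?_
      rw [tendsto_iff_dist_tendsto_zero]
      exact squeeze_zero (fun _ => dist_nonneg) (fun j => hwk j x) hB2
  obtain ⟨K, hK⟩ := hc.exists_bound_of_continuous (hφ 0).continuous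
  have hdom := h.lintegral_dominator hD hD' hr (p := 1) (by norm_num)
  have hdm := h.aemeasurable_dominator (r := r) hD 1
  have hlim2 : Tendsto (fun j => ∫ x, G j x k l * φ x) atTop (𝓝 (∫ x, F x k l * φ x)) := by
    refine tendsto_integral_of_dominated_convergence
      (fun x => (D.indicator (fun _ => |A k l|) x + (dominator r 1 D S A G x).toReal) * K)
      (fun j => (((h.adm j).meas k l).mul (hφ 0).continuous.aemeasurable).aestronglyMeasurable)
      ((((integrable_indicator_iff hD.measurableSet).mpr
        (integrableOn_const hD')).add (integrable_toReal_of_lintegral_ne_top hdm hdom)).mul_const K)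
      (fun j => ?_) ?_
    · filter_upwards [ae_lt_top' hdm hdom] with x hx
      rw [norm_mul]
      refine mul_le_mul ?_ (hK x) (norm_nonneg _)
        (add_nonneg (indicator_nonneg (fun _ _ => abs_nonneg _) _) ENNReal.toReal_nonneg)
      · by_cases hxD : x ∈ D
        · have h1 := h.le_dominator hr zero_le_one hxD j
          rw [Real.rpow_one, ENNReal.ofReal_le_iff_le_toReal hx.ne] at h1
          have h2 := abs_le_frobNorm (A + G j x) k l
          have h3 := abs_sub ((A + G j x) k l) (A k l)
          rw [Matrix.add_apply, add_sub_cancel_left] at h3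
          rw [Matrix.add_apply] at h2
          rw [indicator_of_mem hxD, Real.norm_eq_abs]
          linarith
        · rw [(h.adm j).grad_zero x hxD, Matrix.zero_apply, norm_zero]
          exact add_nonneg (indicator_nonneg (fun _ _ => abs_nonneg _) _) ENNReal.toReal_nonneg
    · filter_upwards [ae_tendsto_of_eventually_const hF] with x hx
      exact (hx k l).mul_const _
  refine tendsto_nhds_unique hlim1 ?_
  simp only [fun j => (h.adm j).weak φ hφ hc k l]
  exact hlim2.neg

/-- The limit of an approximating sequence: a small Hölder perturbation of the linear map `A`
supported in `D` whose total gradient lies in `S`, with weak-`L²` bounds. -/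
lemma exists_exact_perturbation [Nonempty ι] {C : ℝ} (hα0 : 0 < α) (hα1 : α < 1) (hC : 0 ≤ C)
    (hS : ∀ R : ℝ, 1 ≤ R → ∀ X : Matrix ι ι ℝ, (∀ k l, |X k l| ≤ R) →
      Reach α R (cost S R) X (pairSum X + C))
    (hD : IsOpen D) (hDb : Bornology.IsBounded D) (hr : 1 ≤ r) (hA : ∀ k l, |A k l| ≤ r)
    (hε : 0 < ε) :
    ∃ (w : (ι → ℝ) → ι → ℝ) (F : (ι → ℝ) → Matrix ι ι ℝ),
      (∀ x y, dist (w x) (w y) ≤ ε * dist x y ^ α) ∧ (∀ x, x ∉ D → w x = 0) ∧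
      (∀ k l, AEMeasurable fun x => F x k l) ∧
      (∀ φ : (ι → ℝ) → ℝ, (∀ n : ℕ, ContDiff ℝ n φ) → HasCompactSupport φ → ∀ k l,
        ∫ x, w x k * fderiv ℝ φ x (Pi.single l 1) = - ∫ x, F x k l * φ x) ∧
      (∀ᵐ x, x ∈ D → A + F x ∈ S) ∧
      (∀ t : ℝ, 0 < t → volume {x | x ∈ D ∧ t < frobNorm (A + F x)} ≤
        ENNReal.ofReal (4 * Fintype.card ι ^ 2 *
          (4 * Real.exp (8 * (C + 1)) * (Fintype.card ι : ℝ) ^ 4 + 1) * r ^ 2 * t ^ (-2 : ℝ)) *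
          volume D) ∧
      ∀ p : ℝ, 0 ≤ p → p < 2 → IntegrableOn (fun x => frobNorm (A + F x) ^ p) D := by
  have hD' : volume D ≠ ⊤ := hDb.measure_lt_top.ne
  have hr0 : 0 < r := by linarith
  obtain ⟨v, G, h⟩ := exists_approxSeq hα0 hα1 hC hS hD hr hA hε
  obtain ⟨w, hw, hw0, B, hB⟩ := h.exists_limit hα0 hε hDb
  obtain ⟨F, hFG, hF⟩ := h.exists_gradient hD'
  refine ⟨w, F, hw, hw0, h.aemeasurable_limit hF, fun φ hφ hc k l =>
    h.weak_limit hα0 hD hD' hr0.le hF hB hφ hc k l, ?_, fun t ht =>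
    h.volume_limit_le hr0 (by positivity) hFG ht, fun p hp0 hp =>
    h.integrableOn_limit hD hD' hr0.le hF hp0 hp⟩
  filter_upwards [h.ae_exists_mem hD'] with x hx hxD
  obtain ⟨k, hk⟩ := hx hxD
  rwa [hFG k x hk]

end

lemma rpow_le_mul_rpow {s d a b : ℝ} (hs : 0 ≤ s) (hd : s ≤ d) (ha : 0 ≤ a) (hab : a ≤ b) :
    s ^ b ≤ d ^ (b - a) * s ^ a := by
  calc s ^ b = s ^ (b - a) * s ^ a := by
        rw [← Real.rpow_add_of_nonneg hs (sub_nonneg.mpr hab) ha, sub_add_cancel]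
    _ ≤ _ := by
        have := sub_nonneg.mpr hab
        gcongr

section

variable [Fintype ι]

/-- The linear map `x ↦ A x` as a continuous linear map. -/
def lmapCLM (A : Matrix ι ι ℝ) : (ι → ℝ) →L[ℝ] ι → ℝ := A.mulVecLin.toContinuousLinearMap

lemma lmapCLM_apply (A : Matrix ι ι ℝ) (x : ι → ℝ) : lmapCLM A x = lmap A 0 x := by
  ext k
  simp [lmapCLM, lmap, Matrix.mulVec, dotProduct]

lemma continuous_lmap (A : Matrix ι ι ℝ) : Continuous (lmap A 0) := by
  exact (lmapCLM A).continuous.congr (lmapCLM_apply A)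

/-- A function that is Hölder continuous with exponent `b` is so with every smaller exponent on
bounded sets, and adding a linear map does not change this. -/
lemma memHolder_lmap_add {A : Matrix ι ι ℝ} {w : (ι → ℝ) → ι → ℝ} {a b ε : ℝ} {Ω : Set (ι → ℝ)}
    (hΩ : Bornology.IsBounded Ω) (ha : 0 ≤ a) (ha1 : a ≤ 1) (hab : a ≤ b) (hε : 0 ≤ ε)
    (hc : Continuous w) (hw : ∀ x y, dist (w x) (w y) ≤ ε * dist x y ^ b) :
    MemHolder a Ω fun x => lmap A 0 x + w x := by
  obtain ⟨d, hd⟩ := Metric.isBounded_iff.mp hΩ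
  refine ⟨((continuous_lmap A).add hc).continuousOn,
    ‖lmapCLM A‖ * d ^ (1 - a) + ε * d ^ (b - a), fun x hx y hy => ?_⟩
  have h1 : dist (lmap A 0 x) (lmap A 0 y) ≤ ‖lmapCLM A‖ * dist x y := by
    simpa only [← lmapCLM_apply, coe_nnnorm] using (lmapCLM A).lipschitz.dist_le_mul x y
  have h2 := rpow_le_mul_rpow dist_nonneg (hd hx hy) ha ha1
  rw [Real.rpow_one] at h2
  have h3 := rpow_le_mul_rpow dist_nonneg (hd hx hy) ha hab
  calc dist (lmap A 0 x + w x) (lmap A 0 y + w y)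
      ≤ dist (lmap A 0 x) (lmap A 0 y) + dist (w x) (w y) := dist_add_add_le _ _ _ _
    _ ≤ ‖lmapCLM A‖ * (d ^ (1 - a) * dist x y ^ a) + ε * (d ^ (b - a) * dist x y ^ a) :=
      add_le_add (h1.trans (by gcongr)) ((hw x y).trans (by gcongr))
    _ = _ := by ring

lemma exists_holderNorm_bound [Nonempty ι] {a b : ℝ} {Ω : Set (ι → ℝ)}
    (hΩ : Bornology.IsBounded Ω) (ha : 0 ≤ a) (hab : a ≤ b) :
    ∃ K : ℝ, 0 ≤ K ∧ ∀ (w : (ι → ℝ) → ι → ℝ) (ε : ℝ), 0 ≤ ε →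
      (∀ x y, dist (w x) (w y) ≤ ε * dist x y ^ b) → (∀ x ∉ Ω, w x = 0) →
      holderNorm a (closure Ω) w ≤ ε * K := by
  obtain ⟨ρ, hρ, hρΩ⟩ := exists_bounded_dist_compl hΩ.closure
  obtain ⟨d, hd⟩ := Metric.isBounded_iff.mp hΩ.closure
  refine ⟨ρ ^ b + |d| ^ (b - a), by positivity, fun w ε hε hw h0 => ?_⟩
  rw [mul_add]
  refine add_le_add (Real.sSup_le ?_ (by positivity)) (Real.sSup_le ?_ (by positivity))
  · rintro _ ⟨x, hx, rfl⟩
    obtain ⟨y, hy, hxy⟩ := hρΩ x hx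
    have h1 := hw x y
    rw [h0 y fun h => hy (subset_closure h), dist_zero_right] at h1
    have := ha.trans hab
    exact h1.trans (by gcongr)
  · rintro _ ⟨x, hx, y, hy, hxy, rfl⟩
    have hpos := Real.rpow_pos_of_pos (dist_pos.mpr hxy) a
    rw [div_le_iff₀ hpos, mul_assoc]
    exact (hw x y).trans (mul_le_mul_of_nonneg_left
      (rpow_le_mul_rpow dist_nonneg ((hd hx hy).trans (le_abs_self d)) ha hab) hε)

end

section

variable [Fintype ι] [DecidableEq ι]

lemma integral_lmap_mul_fderiv (A : Matrix ι ι ℝ) {φ : (ι → ℝ) → ℝ}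
    (hφ : ∀ n : ℕ, ContDiff ℝ n φ) (hc : HasCompactSupport φ) (k l : ι) :
    ∫ x, lmap A 0 x k * fderiv ℝ φ x (Pi.single l 1) = - ∫ x, A k l * φ x := by
  set L : (ι → ℝ) →L[ℝ] ℝ := (coordL k).comp (lmapCLM A) with hL
  have hLx : ∀ x, L x = lmap A 0 x k := fun x => by rw [← lmapCLM_apply]; rfl
  have hLl : L (Pi.single l 1) = A k l := by simp [hLx, lmap, Pi.single_apply]
  simp only [← hLx]
  refine integral_mul_fderiv_eq_neg L.lipschitz hφ hc _ (ae_of_all _ fun x _ => ?_)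
  rw [← hLl]
  exact L.hasFDerivAt.hasLineDerivAt _

lemma hasWeakGradientOn_lmap_add {A : Matrix ι ι ℝ} {w : (ι → ℝ) → ι → ℝ}
    {F : (ι → ℝ) → Matrix ι ι ℝ} {Ω : Set (ι → ℝ)} (hΩb : Bornology.IsBounded Ω)
    (hw : Continuous w) (hF : ∀ k l, AEMeasurable fun x => F x k l)
    (hI : IntegrableOn (fun x => frobNorm (A + F x)) Ω)
    (hweak : ∀ φ : (ι → ℝ) → ℝ, (∀ n : ℕ, ContDiff ℝ n φ) → HasCompactSupport φ → ∀ k l,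
      ∫ x, w x k * fderiv ℝ φ x (Pi.single l 1) = - ∫ x, F x k l * φ x) :
    HasWeakGradientOn (fun x => lmap A 0 x + w x) (fun x => A + F x) Ω := by
  have hG : ∀ k l, IntegrableOn (fun x => (A + F x) k l) Ω := fun k l =>
    hI.mono' ((hF k l).const_add _).aestronglyMeasurable.restrict
      (ae_of_all _ fun x => abs_le_frobNorm _ k l)
  refine ⟨?_, hG, fun φ hφ hc hs k l => ?_⟩
  · exact (((continuous_lmap A).add hw).continuousOn.integrableOn_compact
      hΩb.isCompact_closure).mono_set subset_closure
  · have hφc : Continuous φ := (hφ 0).continuous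
    obtain ⟨hd1, hd2⟩ := integrable_fderiv_apply hφ hc (Pi.single l (1 : ℝ))
    have hφ0 : ∀ x ∉ Ω, φ x = 0 := fun x hx => image_eq_zero_of_notMem_tsupport fun h => hx (hs h)
    have hd0 : ∀ x ∉ Ω, fderiv ℝ φ x (Pi.single l 1) = 0 := fun x hx => by
      rw [image_eq_zero_of_notMem_tsupport fun h => hx (hs (tsupport_fderiv_subset ℝ h))]; rfl
    have hFφ : Integrable fun x => F x k l * φ x := by
      obtain ⟨K, hK⟩ := hc.exists_bound_of_continuous hφc
      have h1 : IntegrableOn (fun x => F x k l) Ω := by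
        have h2 := (hG k l).sub (integrableOn_const (C := A k l) hΩb.measure_lt_top.ne)
        simpa [Pi.sub_def] using h2
      refine (integrableOn_iff_integrable_of_support_subset (s := Ω) fun x hx => ?_).mp
        (h1.mul_bdd (c := K) hφc.aestronglyMeasurable (ae_of_all _ hK))
      by_contra h
      exact hx (by simp [hφ0 x h])
    rw [setIntegral_eq_integral_of_forall_compl_eq_zero fun x hx => by rw [hd0 x hx, mul_zero],
      setIntegral_eq_integral_of_forall_compl_eq_zero fun x hx => by rw [hφ0 x hx, mul_zero]]
    simp only [Pi.add_apply, Matrix.add_apply, add_mul]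
    have h1 : Continuous fun x => lmap A 0 x k := (continuous_apply k).comp (continuous_lmap A)
    have h2 : Continuous fun x => w x k := (continuous_apply k).comp hw
    rw [integral_add (integrable_mul_of_continuous h1 hd1 hd2)
      (integrable_mul_of_continuous h2 hd1 hd2), integral_add (integrable_mul_of_continuous continuous_const hφc hc) hFφ,
      integral_lmap_mul_fderiv A hφ hc, hweak φ hφ hc, neg_add]

/-- If a component of `u` does not depend on the `j`-th coordinate inside a bounded open set, then
neither does the corresponding component of its linear boundary values. -/
lemma entry_eq_zero_of_const {A : Matrix ι ι ℝ} {u : (ι → ℝ) → ι → ℝ} {Ω : Set (ι → ℝ)}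
    (hΩ : IsOpen Ω) (hΩb : Bornology.IsBounded Ω) (hne : Ω.Nonempty) (hu : Continuous u)
    (hb : ∀ x ∈ frontier Ω, u x = lmap A 0 x) {i j : ι}
    (h : ∀ x ∈ Ω, ∀ y ∈ Ω, (∀ m, m ≠ j → x m = y m) → u x i = u y i) : A i j = 0 := by
  obtain ⟨z, hz⟩ := hne
  set γ : ℝ → ι → ℝ := fun s => z + s • Pi.single j 1 with hγdef
  have hγ : Continuous γ := by fun_prop
  set T : Set ℝ := γ ⁻¹' Ω with hTdef
  have hT : IsOpen T := hΩ.preimage hγ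
  have h0 : (0 : ℝ) ∈ T := by simpa [hTdef, hγdef] using hz
  have hTb : Bornology.IsBounded T := by
    obtain ⟨d, hd⟩ := Metric.isBounded_iff.mp hΩb
    refine (Metric.isBounded_iff_subset_closedBall 0).mpr ⟨d, fun s hs => ?_⟩
    have h1 := (dist_le_pi_dist (γ s) (γ 0) j).trans (hd hs h0)
    simpa [hγdef, Real.dist_eq] using h1
  have hcl : ∀ s ∈ closure T, u (γ s) i = u z i := fun s hs => by
    refine closure_minimal (t := {s | u (γ s) i = u z i}) (fun t ht => ?_)
      (isClosed_eq ((continuous_apply i).comp (hu.comp hγ)) continuous_const) hs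
    exact h _ ht _ hz fun m hm => by simp [hγdef, hm]
  have hfr : ∀ s ∈ closure T, s ∉ T → lmap A 0 (γ s) i = u z i := fun s hs hsT => by
    rw [← hcl s hs, hb]
    rw [hΩ.frontier_eq]
    exact ⟨hγ.closure_preimage_subset Ω hs, hsT⟩
  have hl : ∀ s, lmap A 0 (γ s) i = lmap A 0 z i + s * A i j := fun s => by
    rw [← lmapCLM_apply, ← lmapCLM_apply, map_add, map_smul]
    simp [lmapCLM]
  have hlt : sInf T < sSup T := by
    obtain ⟨ε, hε, hball⟩ := Metric.isOpen_iff.mp hT 0 h0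
    have h1 : ε / 2 ∈ T := hball (by
      rw [Metric.mem_ball, Real.dist_0_eq_abs, abs_of_pos (by positivity)]; linarith)
    linarith [csInf_le hTb.bddBelow h0, le_csSup hTb.bddAbove h1]
  have hsup : sSup T ∉ T := fun hmem => by
    obtain ⟨s, hs, hsT⟩ := (eventually_mem_nhdsWithin.and
      (nhdsWithin_le_nhds (s := Ioi (sSup T)) (hT.mem_nhds hmem))).exists
    exact (le_csSup hTb.bddAbove hsT).not_gt hs
  have hinf : sInf T ∉ T := fun hmem => by
    obtain ⟨s, hs, hsT⟩ := (eventually_mem_nhdsWithin.and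
      (nhdsWithin_le_nhds (s := Iio (sInf T)) (hT.mem_nhds hmem))).exists
    exact (csInf_le hTb.bddBelow hsT).not_gt hs
  have h1 := hfr _ (csSup_mem_closure ⟨0, h0⟩ hTb.bddAbove) hsup
  have h2 := hfr _ (csInf_mem_closure ⟨0, h0⟩ hTb.bddBelow) hinf
  rw [hl] at h1 h2
  have h3 : (sSup T - sInf T) * A i j = 0 := by linarith
  exact (mul_eq_zero.mp h3).resolve_left (by linarith)

end

lemma mem_LSet_of_isSplitOn {n : ℕ} {A : Matrix (Fin n ⊕ Fin n) (Fin n ⊕ Fin n) ℝ}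
    {u : ((Fin n ⊕ Fin n) → ℝ) → (Fin n ⊕ Fin n) → ℝ} {Ω : Set ((Fin n ⊕ Fin n) → ℝ)}
    (hΩ : IsOpen Ω) (hΩb : Bornology.IsBounded Ω) (hne : Ω.Nonempty) (hu : Continuous u)
    (hb : ∀ x ∈ frontier Ω, u x = lmap A 0 x) (hs : IsSplitOn n u Ω) : A ∈ LSet n := by
  rcases hs with ⟨f₁, f₂, hf⟩ | ⟨f₁, f₂, hf⟩
  · refine Or.inl ⟨fun i j => ?_, fun i j => ?_⟩ <;>
      refine entry_eq_zero_of_const hΩ hΩb hne hu hb fun x hx y hy hxy => ?_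
    · rw [(hf x hx).1, (hf y hy).1, funext fun m => hxy (Sum.inl m) Sum.inl_ne_inr]
    · rw [(hf x hx).2, (hf y hy).2, funext fun m => hxy (Sum.inr m) Sum.inr_ne_inl]
  · refine Or.inr ⟨fun i j => ?_, fun i j => ?_⟩ <;>
      refine entry_eq_zero_of_const hΩ hΩb hne hu hb fun x hx y hy hxy => ?_
    · rw [(hf x hx).1, (hf y hy).1, funext fun m => hxy (Sum.inr m) Sum.inr_ne_inl]
    · rw [(hf x hx).2, (hf y hy).2, funext fun m => hxy (Sum.inl m) Sum.inl_ne_inr]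

/-- Theorem (breakdown of rigidity for low Sobolev exponents). -/
theorem product_rigidity_breakdown (n : ℕ) (hn : 0 < n) :
    ∃ M : ℝ, 1 ≤ M ∧
      ∀ Ω : Set ((Fin n ⊕ Fin n) → ℝ), IsRegularDomain Ω →
      ∀ A : Matrix (Fin n ⊕ Fin n) (Fin n ⊕ Fin n) ℝ,
      ∀ α : ℝ, α ∈ Set.Ico (0:ℝ) 1 → ∀ δ : ℝ, 0 < δ →
      ∃ (u : ((Fin n ⊕ Fin n) → ℝ) → (Fin n ⊕ Fin n) → ℝ)
        (G : ((Fin n ⊕ Fin n) → ℝ) → Matrix (Fin n ⊕ Fin n) (Fin n ⊕ Fin n) ℝ),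
        HasWeakGradientOn u G Ω ∧
        MemHolder α (closure Ω) u ∧
        (∀ x ∈ frontier Ω, u x = lmap A 0 x) ∧
        holderNorm α (closure Ω) (fun x => u x - lmap A 0 x) < δ ∧
        (∀ᵐ x ∂(volume.restrict Ω), G x ∈ LSet n ∩ SigmaSet n) ∧
        (∀ t : ℝ, 0 < t →
          volume {x ∈ Ω | t < frobNorm (G x)}
            ≤ ENNReal.ofReal (M * (1 + frobNorm A ^ 2) * t ^ (-2 : ℝ)) * volume Ω) ∧
        (∀ p : ℝ, 1 ≤ p → p < 2 →
          IntegrableOn (fun x => frobNorm (G x) ^ p) Ω volume) ∧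
        (A ∉ LSet n → ¬ IsSplitOn n u Ω) := by
  have : Nonempty (Fin n) := ⟨⟨0, hn⟩⟩
  set N : ℝ := (Fintype.card (Fin n ⊕ Fin n) : ℝ) with hN
  have hN1 : 1 ≤ N := by
    rw [hN, Nat.one_le_cast]
    exact Fintype.card_pos
  refine ⟨4 * N ^ 2 * (4 * Real.exp (8 * (4 * N ^ 4 + 1)) * N ^ 4 + 1), ?_, ?_⟩
  · have h1 : 1 ≤ N ^ 2 := one_le_pow₀ hN1
    have h2 : 0 ≤ 4 * Real.exp (8 * (4 * N ^ 4 + 1)) * N ^ 4 := by positivity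
    nlinarith
  rintro Ω ⟨hΩ, hΩb, hΩc, -⟩ A α ⟨hα0, hα1⟩ δ hδ
  set β : ℝ := (1 + α) / 2 with hβ
  have hαβ : α ≤ β := by rw [hβ]; linarith
  have hβ0 : 0 < β := by rw [hβ]; linarith
  have hβ1 : β < 1 := by rw [hβ]; linarith
  obtain ⟨K, hK0, hK⟩ := exists_holderNorm_bound hΩb hα0 hαβ
  have hr2 : Real.sqrt (1 + frobNorm A ^ 2) ^ 2 = 1 + frobNorm A ^ 2 :=
    Real.sq_sqrt (by positivity)
  obtain ⟨w, F, hw, hw0, hF, hweak, hS, hvol, hint⟩ := exists_exact_perturbation (A := A)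
    (r := Real.sqrt (1 + frobNorm A ^ 2)) (ε := δ / (K + 1)) (S := LSet n ∩ SigmaSet n)
    (C := 4 * N ^ 4) hβ0 hβ1 (by positivity)
    (fun R hR X hX => reach_split hn hβ0 hβ1 hR hX) hΩ hΩb
    (Real.one_le_sqrt.mpr (by linarith [sq_nonneg (frobNorm A)]))
    (fun k l => (abs_le_frobNorm A k l).trans (Real.le_sqrt_of_sq_le (by linarith)))
    (by positivity)
  have hwc : Continuous w := continuous_of_holder hβ0 hw
  have hfr : ∀ x ∈ frontier Ω, lmap A 0 x + w x = lmap A 0 x := fun x hx => by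
    rw [hΩ.frontier_eq] at hx
    rw [hw0 x hx.2, add_zero]
  refine ⟨fun x => lmap A 0 x + w x, fun x => A + F x, ?_, ?_, hfr, ?_, ?_, fun t ht => ?_,
    fun p hp1 hp => hint p (by linarith) hp, fun hA hs => hA ?_⟩
  · exact hasWeakGradientOn_lmap_add hΩb hwc hF
      (by simpa using hint 1 zero_le_one one_lt_two) hweak
  · exact memHolder_lmap_add hΩb.closure hα0 hα1.le hαβ (by positivity) hwc hw
  · simp only [add_sub_cancel_left]
    refine (hK w _ (by positivity) hw hw0).trans_lt ?_
    rw [div_mul_eq_mul_div, div_lt_iff₀ (by positivity)]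
    linarith
  · exact (ae_restrict_iff' hΩ.measurableSet).mpr hS
  · have := hvol t ht
    rwa [hr2] at this
  · exact mem_LSet_of_isSplitOn hΩ hΩb hΩc.nonempty ((continuous_lmap A).add hwc) hfr hs

end Paper
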